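/- Fix an integer n ≥ 2 and a splitting type r. For any function x = x(N) with x(N) → ∞ and x(N) ≤ N^{1/log log N}, and any real numbers a < b, one has ℙ_N( a ≤ (π_{f,r}(x) − δ(r)π(x)) / ((δ(r)−δ(r)²)^{1/2}·π(x)^{1/2}) ≤ b ) → (1/√(2π))·∫_a^b e^{−t²/2} dt as N → ∞. -/

import Mathlib

/-!
Arithmetic statistics of families of integer `S_n`-polynomials (I. Viglino).

`𝒫_{n,N}` is the family of monic integer polynomials
`f(X) = X^n + a_{n-1}X^{n-1} + ⋯ + a_0` with `|a_i| ≤ N`, identified with their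
coefficient vectors `a : Fin n → ℤ`, and `𝒫⁰_{n,N} ⊆ 𝒫_{n,N}` is the subfamily of
`f` whose splitting field over `ℚ` has Galois group isomorphic to `S_n`.
-/

open Polynomial Finset Filter

attribute [local instance] Classical.propDecidable

noncomputable section

/-- The monic integer polynomial `X^n + a_{n-1}X^{n-1} + ⋯ + a_0`. -/
def intPoly (n : ℕ) (a : Fin n → ℤ) : Polynomial ℤ :=
  Polynomial.X ^ n + ∑ i : Fin n, Polynomial.C (a i) * Polynomial.X ^ (i : ℕ)

/-- The same polynomial viewed over `ℚ`. -/
def ratPoly (n : ℕ) (a : Fin n → ℤ) : Polynomial ℚ :=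
  (intPoly n a).map (Int.castRingHom ℚ)

/-- Coefficient vectors with entries in `{-N, …, N}`: the family `𝒫_{n,N}`. -/
def coeffBox (n N : ℕ) : Finset (Fin n → ℤ) :=
  Fintype.piFinset fun _ => Finset.Icc (-(N : ℤ)) (N : ℤ)

/-- `f` is an `S_n`-polynomial: the Galois group of its splitting field `K_f` over `ℚ`
is isomorphic to the symmetric group on `n` letters. -/
def IsSnPoly (n : ℕ) (a : Fin n → ℤ) : Prop :=
  Nonempty ((ratPoly n a).Gal ≃* Equiv.Perm (Fin n))

/-- The family `𝒫⁰_{n,N}` of `S_n`-polynomials, as a finset of coefficient vectors. -/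
def P0 (n N : ℕ) : Finset (Fin n → ℤ) :=
  (coeffBox n N).filter fun a => IsSnPoly n a

/-- `ℙ_N`, the uniform probability of an event in `𝒫⁰_{n,N}`. -/
def probN (n N : ℕ) (E : (Fin n → ℤ) → Prop) : ℝ :=
  (((P0 n N).filter E).card : ℝ) / ((P0 n N).card : ℝ)

/-- `𝔼_N`, the expectation of a real random variable on `𝒫⁰_{n,N}`. -/
def expN (n N : ℕ) (F : (Fin n → ℤ) → ℝ) : ℝ :=
  (∑ a ∈ P0 n N, F a) / ((P0 n N).card : ℝ)

/-- `π(x)`, the number of rational primes `≤ x`. -/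
def primePi (x : ℝ) : ℕ :=
  ((Finset.range (⌊x⌋₊ + 1)).filter Nat.Prime).card

/-- `g ∈ 𝔽_p[X]` has splitting type `r = (r_1, …, r_n)` — encoded by `r : Fin n → ℕ` where
`r i` is `r_{i+1}`, the number of factors of degree `i+1` —, i.e. `g` is a product of
distinct monic irreducible polynomials with exactly `r i` monic irreducible factors of
degree `i+1` for each `i`. -/
def SplitTypeOf {p : ℕ} (g : Polynomial (ZMod p)) {n : ℕ} (r : Fin n → ℕ) : Prop :=
  Squarefree g ∧ ∀ i : Fin n,
    Nat.card {h : Polynomial (ZMod p) // h.Monic ∧ Irreducible h ∧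
      h.natDegree = (i : ℕ) + 1 ∧ h ∣ g} = r i

/-- `f` has splitting type `r` modulo `p`. -/
def HasSplitType (n : ℕ) (r : Fin n → ℕ) (a : Fin n → ℤ) (p : ℕ) : Prop :=
  SplitTypeOf ((intPoly n a).map (Int.castRingHom (ZMod p))) r

/-- `π_{f,r}(x)`: the number of primes `p ≤ x` such that `f` has splitting type `r` mod `p`. -/
def countSplit (n : ℕ) (r : Fin n → ℕ) (a : Fin n → ℤ) (x : ℝ) : ℕ :=
  ((Finset.range (⌊x⌋₊ + 1)).filter fun p => p.Prime ∧ HasSplitType n r a p).card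

/-- `δ(r) = ∏_{i=1}^n 1/(i^{r_i}·r_i!)`. -/
def splitDelta (n : ℕ) (r : Fin n → ℕ) : ℝ :=
  ∏ i : Fin n, (1 : ℝ) / ((((i : ℕ) + 1) ^ (r i) * Nat.factorial (r i) : ℕ) : ℝ)

/-- `r_i` as a function of the index `i ≥ 1` (so `rget n r 1 = r_1`, etc.). -/
def rget (n : ℕ) (r : Fin n → ℕ) (i : ℕ) : ℕ :=
  if h : i - 1 < n then r ⟨i - 1, h⟩ else 0

/-- `C_r = δ(r)·r_2(r_2−1)(r_1+1)(r_1+2)/(2^{r_2+1}·r_1!·r_2!)`. -/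
def splitCr (n : ℕ) (r : Fin n → ℕ) : ℝ :=
  splitDelta n r *
    ((rget n r 2 : ℝ) * ((rget n r 2 : ℝ) - 1) *
      ((rget n r 1 : ℝ) + 1) * ((rget n r 1 : ℝ) + 2)) /
    ((2 : ℝ) ^ (rget n r 2 + 1) * (Nat.factorial (rget n r 1) : ℝ) *
      (Nat.factorial (rget n r 2) : ℝ))

/-- Taylor remainder of `t ↦ exp (i t)` on the nonnegative half-line. -/
lemma norm_exp_mul_I_sub_sum_le_of_nonneg (K : ℕ) {y : ℝ} (hy : 0 ≤ y) :
    ‖Complex.exp (y * Complex.I) - ∑ k ∈ range K, (y * Complex.I) ^ k / (k.factorial : ℂ)‖ ≤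
      y ^ K / K.factorial := by
  induction K generalizing y with
  | zero => simp
  | succ K ih =>
    have hderiv (t : ℝ) : HasDerivAt (fun t : ℝ => Complex.exp (t * Complex.I) -
        ∑ k ∈ range (K + 1), (t * Complex.I) ^ k / (k.factorial : ℂ))
        (Complex.I * (Complex.exp (t * Complex.I) -
          ∑ k ∈ range K, (t * Complex.I) ^ k / (k.factorial : ℂ))) t := by
      have h0 : HasDerivAt (fun t : ℝ => (t : ℂ) * Complex.I) Complex.I t := by
        simpa using (Complex.ofRealCLM.hasDerivAt (x := t)).mul_const Complex.I
      have h1 := h0.cexp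
      have h2 : HasDerivAt (fun t : ℝ => ∑ k ∈ range (K + 1),
          ((t : ℂ) * Complex.I) ^ k / (k.factorial : ℂ))
          (∑ k ∈ range (K + 1), (k * ((t : ℂ) * Complex.I) ^ (k - 1) * Complex.I) /
            (k.factorial : ℂ)) t :=
        HasDerivAt.fun_sum fun k _ => (h0.pow k).div_const _
      refine (h1.sub h2).congr_deriv ?_
      rw [sum_range_succ', mul_sub, mul_sum]
      simp only [Nat.factorial_succ, Nat.add_sub_cancel, CharP.cast_eq_zero, zero_mul, zero_div,
        add_zero]
      rw [mul_comm]
      congr 1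
      refine sum_congr rfl fun k _ => ?_
      have : (k.factorial : ℂ) ≠ 0 := by exact_mod_cast k.factorial_ne_zero
      have : ((k : ℂ) + 1) ≠ 0 := by exact_mod_cast k.succ_ne_zero
      push_cast
      field_simp
    have hB (t : ℝ) : HasDerivAt (fun t : ℝ => t ^ (K + 1) / ((K + 1).factorial : ℝ))
        (t ^ K / K.factorial) t := by
      refine ((hasDerivAt_pow (K + 1) t).div_const _).congr_deriv ?_
      have : (K.factorial : ℝ) ≠ 0 := by exact_mod_cast K.factorial_ne_zero
      have : ((K : ℝ) + 1) ≠ 0 := by exact_mod_cast K.succ_ne_zero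
      rw [Nat.factorial_succ]
      push_cast
      field_simp
    refine image_norm_le_of_norm_deriv_right_le_deriv_boundary' (a := 0) (b := y)
      (fun t _ => (hderiv t).continuousAt.continuousWithinAt)
      (fun t _ => (hderiv t).hasDerivWithinAt) ?_
      (fun t _ => (hB t).continuousAt.continuousWithinAt)
      (fun t _ => (hB t).hasDerivWithinAt) (fun t ht => ?_) ⟨hy, le_rfl⟩
    · simp [sum_range_succ']
    · rw [norm_mul, Complex.norm_I, one_mul]
      exact ih ht.1

/-- Taylor remainder of `t ↦ exp (i t)`. -/
lemma norm_exp_mul_I_sub_sum_le (K : ℕ) (y : ℝ) :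
    ‖Complex.exp (y * Complex.I) - ∑ k ∈ range K, (y * Complex.I) ^ k / (k.factorial : ℂ)‖ ≤
      |y| ^ K / K.factorial := by
  rcases le_total 0 y with hy | hy
  · rw [abs_of_nonneg hy]
    exact norm_exp_mul_I_sub_sum_le_of_nonneg K hy
  · rw [abs_of_nonpos hy]
    have h := norm_exp_mul_I_sub_sum_le_of_nonneg K (neg_nonneg.2 hy)
    rw [← Complex.norm_conj] at h
    convert h using 2
    simp [← Complex.exp_conj]

/-- Taylor expansion of the characteristic function of a finitely supported law. -/
lemma norm_charSum_sub_taylor_le {γ : Type*} (u : Finset γ) (v : γ → ℝ)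
    (hv : ∀ c ∈ u, 0 ≤ v c) (Y : γ → ℝ) (t : ℝ) {K : ℕ} (hK : Even K) :
      ‖∑ c ∈ u, (v c : ℂ) * Complex.exp ((t * Y c : ℝ) * Complex.I) -
        ∑ k ∈ range K, (t * Complex.I) ^ k / (k.factorial : ℂ) *
          ((∑ c ∈ u, v c * Y c ^ k : ℝ) : ℂ)‖ ≤
      |t| ^ K / K.factorial * ∑ c ∈ u, v c * Y c ^ K := by
    have e : ∑ k ∈ range K, (t * Complex.I) ^ k / (k.factorial : ℂ) *
          ((∑ c ∈ u, v c * Y c ^ k : ℝ) : ℂ) =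
        ∑ c ∈ u, (v c : ℂ) * ∑ k ∈ range K, ((t * Y c : ℝ) * Complex.I) ^ k /
          (k.factorial : ℂ) := by
      push_cast
      simp_rw [mul_sum]
      rw [sum_comm]
      refine sum_congr rfl fun c _ => sum_congr rfl fun k _ => ?_
      ring
    rw [e, ← sum_sub_distrib, mul_sum]
    refine (norm_sum_le _ _).trans (sum_le_sum fun c hc => ?_)
    rw [← mul_sub, norm_mul, Complex.norm_real, Real.norm_of_nonneg (hv c hc)]
    refine (mul_le_mul_of_nonneg_left (norm_exp_mul_I_sub_sum_le K (t * Y c)) (hv c hc)).trans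
      (le_of_eq ?_)
    rw [abs_mul, mul_pow, hK.pow_abs (Y c)]
    ring

/-- Comparison of characteristic functions of two finitely supported probability laws through
their first `K` moments. -/
lemma norm_charSum_sub_le {α β : Type*} (s : Finset α) (s' : Finset β) (w : α → ℝ) (w' : β → ℝ)
    (hw : ∀ a ∈ s, 0 ≤ w a) (hw' : ∀ b ∈ s', 0 ≤ w' b) (Z : α → ℝ) (W : β → ℝ) (t : ℝ)
    {K : ℕ} (hK : Even K) :
    ‖∑ a ∈ s, (w a : ℂ) * Complex.exp ((t * Z a : ℝ) * Complex.I) -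
        ∑ b ∈ s', (w' b : ℂ) * Complex.exp ((t * W b : ℝ) * Complex.I)‖ ≤
      ∑ k ∈ range K, |t| ^ k / k.factorial *
          |∑ a ∈ s, w a * Z a ^ k - ∑ b ∈ s', w' b * W b ^ k| +
        |t| ^ K / K.factorial * (|∑ a ∈ s, w a * Z a ^ K - ∑ b ∈ s', w' b * W b ^ K| +
          2 * ∑ b ∈ s', w' b * W b ^ K) := by
  have h1 := norm_charSum_sub_taylor_le s w hw Z t hK
  have h2 := norm_charSum_sub_taylor_le s' w' hw' W t hK
  set A := ∑ a ∈ s, (w a : ℂ) * Complex.exp ((t * Z a : ℝ) * Complex.I)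
  set B := ∑ b ∈ s', (w' b : ℂ) * Complex.exp ((t * W b : ℝ) * Complex.I)
  set A' := ∑ k ∈ range K, (t * Complex.I) ^ k / (k.factorial : ℂ) *
    ((∑ c ∈ s, w c * Z c ^ k : ℝ) : ℂ) with hA'
  set B' := ∑ k ∈ range K, (t * Complex.I) ^ k / (k.factorial : ℂ) *
    ((∑ c ∈ s', w' c * W c ^ k : ℝ) : ℂ) with hB'
  have h3 : ‖A' - B'‖ ≤ ∑ k ∈ range K, |t| ^ k / k.factorial *
      |∑ a ∈ s, w a * Z a ^ k - ∑ b ∈ s', w' b * W b ^ k| := by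
    rw [hA', hB', ← sum_sub_distrib]
    refine (norm_sum_le _ _).trans (sum_le_sum fun k _ => ?_)
    rw [← mul_sub, norm_mul, ← Complex.ofReal_sub, Complex.norm_real]
    simp
  have h4 : ‖A - B‖ ≤ ‖A - A'‖ + ‖A' - B'‖ + ‖B - B'‖ := by
    have : A - B = (A - A') + (A' - B') - (B - B') := by ring
    rw [this]
    exact (norm_sub_le _ _).trans (by gcongr; exact norm_add_le _ _)
  have h5 : ∑ a ∈ s, w a * Z a ^ K ≤ |∑ a ∈ s, w a * Z a ^ K - ∑ b ∈ s', w' b * W b ^ K| +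
      ∑ b ∈ s', w' b * W b ^ K := by
    linarith [le_abs_self (∑ a ∈ s, w a * Z a ^ K - ∑ b ∈ s', w' b * W b ^ K)]
  have h6 := mul_le_mul_of_nonneg_left h5 (by positivity : 0 ≤ |t| ^ K / (K.factorial : ℝ))
  linarith

lemma pow_le_factorial_mul_exp {K : ℕ} (hK : Even K) (y : ℝ) :
    y ^ K ≤ K.factorial * (Real.exp y + Real.exp (-y)) := by
  have h : y ^ K / K.factorial ≤ Real.exp |y| := by
    rw [← hK.pow_abs]
    exact Real.pow_div_factorial_le_exp _ (abs_nonneg y) K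
  have h2 : Real.exp |y| ≤ Real.exp y + Real.exp (-y) := Real.exp_abs_le y
  rw [div_le_iff₀ (by positivity)] at h
  nlinarith [(Nat.cast_pos (α := ℝ)).2 K.factorial_pos]

/-- If the moments of `Z` are asymptotic to those of `W`, and `W` has bounded exponential moments,
then the characteristic functions of `Z` and `W` are asymptotic. -/
lemma tendsto_charSum_sub {α β : Type*} (s : ℕ → Finset α) (s' : ℕ → Finset β)
    (w : ℕ → α → ℝ) (w' : ℕ → β → ℝ)
    (hw : ∀ N, ∀ a ∈ s N, 0 ≤ w N a) (hw' : ∀ N, ∀ b ∈ s' N, 0 ≤ w' N b)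
    (Z : ℕ → α → ℝ) (W : ℕ → β → ℝ)
    (hmom : ∀ k : ℕ, Tendsto (fun N => ∑ a ∈ s N, w N a * Z N a ^ k -
      ∑ b ∈ s' N, w' N b * W N b ^ k) atTop (nhds 0))
    (hexp : ∀ l : ℝ, ∃ B : ℝ, ∀ᶠ N in atTop,
      ∑ b ∈ s' N, w' N b * Real.exp (l * W N b) ≤ B) (t : ℝ) :
    Tendsto (fun N => ∑ a ∈ s N, (w N a : ℂ) * Complex.exp ((t * Z N a : ℝ) * Complex.I) -
      ∑ b ∈ s' N, (w' N b : ℂ) * Complex.exp ((t * W N b : ℝ) * Complex.I)) atTop (nhds 0) := by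
  rw [Metric.tendsto_atTop']
  suffices h : ∀ ε > 0, ∀ᶠ N in atTop,
      ‖∑ a ∈ s N, (w N a : ℂ) * Complex.exp ((t * Z N a : ℝ) * Complex.I) -
      ∑ b ∈ s' N, (w' N b : ℂ) * Complex.exp ((t * W N b : ℝ) * Complex.I)‖ < ε by
    intro ε hε
    obtain ⟨N, hN⟩ := eventually_atTop.1 (h ε hε)
    exact ⟨N, fun M hM => by simpa [dist_zero_right] using hN M hM.le⟩
  intro ε hε
  set l : ℝ := 2 * (|t| + 1) with hl
  have hlpos : 0 < l := by positivity
  obtain ⟨B₁, hB₁⟩ := hexp l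
  obtain ⟨B₂, hB₂⟩ := hexp (-l)
  obtain ⟨j, hj⟩ := exists_pow_lt_of_lt_one
    (show 0 < ε / (4 * (|B₁| + |B₂| + 1)) by positivity) (by norm_num : (1 / 2 : ℝ) < 1)
  set K := 2 * j with hKdef
  have hK : Even K := even_two_mul j
  have hmain : Tendsto (fun N => ∑ k ∈ range K, |t| ^ k / k.factorial *
          |∑ a ∈ s N, w N a * Z N a ^ k - ∑ b ∈ s' N, w' N b * W N b ^ k| +
        |t| ^ K / K.factorial * |∑ a ∈ s N, w N a * Z N a ^ K -
          ∑ b ∈ s' N, w' N b * W N b ^ K|) atTop (nhds 0) := by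
    have h0 (k : ℕ) : Tendsto (fun N => |t| ^ k / k.factorial *
          |∑ a ∈ s N, w N a * Z N a ^ k - ∑ b ∈ s' N, w' N b * W N b ^ k|) atTop (nhds 0) := by
      simpa using ((hmom k).abs).const_mul (|t| ^ k / k.factorial)
    simpa using (tendsto_finsetSum (range K) fun k _ => h0 k).add (h0 K)
  filter_upwards [hmain.eventually (gt_mem_nhds (half_pos hε)), hB₁, hB₂] with N h1 h2 h3
  refine (norm_charSum_sub_le (s N) (s' N) (w N) (w' N) (hw N) (hw' N) (Z N) (W N) t hK).trans_lt ?_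
  have h4 : ∑ b ∈ s' N, w' N b * W N b ^ K ≤ K.factorial / l ^ K * (|B₁| + |B₂| + 1) := by
    have : ∑ b ∈ s' N, w' N b * W N b ^ K ≤ ∑ b ∈ s' N, K.factorial / l ^ K *
        (w' N b * Real.exp (l * W N b) + w' N b * Real.exp (-l * W N b)) := by
      refine sum_le_sum fun b hb => ?_
      have := mul_le_mul_of_nonneg_left (pow_le_factorial_mul_exp hK (l * W N b)) (hw' N b hb)
      rw [mul_pow] at this
      rw [div_mul_eq_mul_div, le_div_iff₀ (by positivity)]
      rw [neg_mul]
      linarith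
    refine this.trans ?_
    rw [← mul_sum, sum_add_distrib]
    refine mul_le_mul_of_nonneg_left ?_ (by positivity)
    linarith [le_abs_self B₁, le_abs_self B₂]
  have h5 : |t| ^ K / K.factorial * (2 * ∑ b ∈ s' N, w' N b * W N b ^ K) < ε / 2 := by
    have hfac : (K.factorial : ℝ) ≠ 0 := by exact_mod_cast K.factorial_ne_zero
    have hle : |t| / l ≤ 1 / 2 := by
      rw [div_le_div_iff₀ hlpos (by norm_num)]; linarith
    have hpow : (|t| / l) ^ K ≤ (1 / 2) ^ j := by
      calc (|t| / l) ^ K ≤ (1 / 2) ^ K := by gcongr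
        _ ≤ (1 / 2) ^ j := pow_le_pow_of_le_one (by norm_num) (by norm_num) (by omega)
    have hD : 0 < |B₁| + |B₂| + 1 := by positivity
    calc |t| ^ K / K.factorial * (2 * ∑ b ∈ s' N, w' N b * W N b ^ K)
        ≤ |t| ^ K / K.factorial * (2 * (K.factorial / l ^ K * (|B₁| + |B₂| + 1))) := by gcongr
      _ = 2 * (|t| / l) ^ K * (|B₁| + |B₂| + 1) := by
          rw [div_pow]; field_simp
      _ ≤ 2 * (1 / 2) ^ j * (|B₁| + |B₂| + 1) := by gcongr
      _ < 2 * (ε / (4 * (|B₁| + |B₂| + 1))) * (|B₁| + |B₂| + 1) := by gcongr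
      _ = ε / 2 := by field_simp; norm_num
  rw [mul_add, ← add_assoc]
  linarith

open MeasureTheory ProbabilityTheory in
/-- Lévy's theorem for empirical distributions on finite sets, with standard Gaussian limit. -/
lemma tendsto_card_filter_div_of_charSum {α : Type*} (s : ℕ → Finset α)
    (hs : ∀ N, (s N).Nonempty) (Z : ℕ → α → ℝ)
    (hchar : ∀ t : ℝ, Tendsto (fun N => ∑ a ∈ s N, (((#(s N) : ℝ)⁻¹ : ℝ) : ℂ) *
      Complex.exp ((t * Z N a : ℝ) * Complex.I)) atTop (nhds (Complex.exp (-t ^ 2 / 2))))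
    {a b : ℝ} (hab : a < b) :
    Tendsto (fun N => (#{f ∈ s N | a ≤ Z N f ∧ Z N f ≤ b} : ℝ) / #(s N)) atTop
      (nhds ((1 / Real.sqrt (2 * Real.pi)) * ∫ t in a..b, Real.exp (-t ^ 2 / 2))) := by
  let ν : ℕ → Measure ℝ := fun N => (#(s N) : ENNReal)⁻¹ • ∑ f ∈ s N, Measure.dirac (Z N f)
  have hcard (N : ℕ) : (#(s N) : ENNReal) ≠ 0 := by
    simpa using (hs N).ne_empty
  have hν_apply (N : ℕ) (S : Set ℝ) (hS : MeasurableSet S) :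
      (ν N).real S = (#{f ∈ s N | Z N f ∈ S} : ℝ) / #(s N) := by
    simp only [ν, measureReal_def, Measure.smul_apply, Measure.finsetSum_apply,
      Measure.dirac_apply' _ hS, smul_eq_mul]
    rw [ENNReal.toReal_mul, ENNReal.toReal_inv, ENNReal.toReal_natCast, card_filter, mul_comm,
      ← div_eq_mul_inv, ENNReal.toReal_sum]
    · push_cast
      congr 1
      refine sum_congr rfl fun f _ => ?_
      by_cases h : Z N f ∈ S <;> simp [h]
    · intro f _
      by_cases h : Z N f ∈ S <;> simp [h]
  have hν_prob (N : ℕ) : IsProbabilityMeasure (ν N) := by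
    constructor
    simp only [ν, Measure.smul_apply, Measure.finsetSum_apply, measure_univ, sum_const,
      nsmul_eq_mul, mul_one, smul_eq_mul]
    exact ENNReal.inv_mul_cancel (hcard N) (ENNReal.natCast_ne_top _)
  let μ : ℕ → ProbabilityMeasure ℝ := fun N => ⟨ν N, hν_prob N⟩
  let γ : ProbabilityMeasure ℝ := ⟨gaussianReal 0 1, inferInstance⟩
  have hlim : Tendsto μ atTop (nhds γ) := by
    rw [ProbabilityMeasure.tendsto_iff_tendsto_charFun]
    intro t
    have hγ : charFun (γ : Measure ℝ) t = Complex.exp (-t ^ 2 / 2) := by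
      simp [γ, charFun_gaussianReal, neg_div]
    rw [hγ]
    refine (hchar t).congr fun N => ?_
    simp only [μ, ν, ProbabilityMeasure.coe_mk, charFun_apply_real]
    rw [integral_smul_measure, integral_finsetSum_measure]
    · simp only [integral_dirac, ENNReal.toReal_inv, ENNReal.toReal_natCast, ← mul_sum]
      rw [Complex.real_smul]
      push_cast
      rfl
    · intro f _
      exact integrable_dirac (by simp [enorm_lt_top])
  have hfr : (γ : Measure ℝ) (frontier (Set.Icc a b)) = 0 := by
    rw [frontier_Icc hab.le]
    have : NullSingletonClass (gaussianReal 0 1) := nullSingletonClass_gaussianReal one_ne_zero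
    simp only [γ, ProbabilityMeasure.coe_mk]
    exact (Set.toFinite _).measure_zero _
  have h := ProbabilityMeasure.tendsto_measure_of_null_frontier_of_tendsto' hlim hfr
  have h' := (ENNReal.tendsto_toReal (measure_ne_top _ _)).comp h
  have hval : ((γ : Measure ℝ) (Set.Icc a b)).toReal =
      (1 / Real.sqrt (2 * Real.pi)) * ∫ t in a..b, Real.exp (-t ^ 2 / 2) := by
    simp only [γ, ProbabilityMeasure.coe_mk]
    rw [gaussianReal_apply_eq_integral 0 one_ne_zero, ENNReal.toReal_ofReal
      (setIntegral_nonneg measurableSet_Icc fun x _ => gaussianPDFReal_nonneg _ _ _),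
      integral_Icc_eq_integral_Ioc, ← intervalIntegral.integral_of_le hab.le,
      ← intervalIntegral.integral_const_mul]
    simp [gaussianPDFReal]
  rw [hval] at h'
  refine h'.congr fun N => ?_
  simpa [measureReal_def, μ] using hν_apply N (Set.Icc a b) measurableSet_Icc

/-- The indicator of a proposition. -/
def propInd (q : Prop) : ℝ := if q then 1 else 0

/-- The weight of the subset `A` of `P` when the elements `p` of `P` are selected independently
with probabilities `d p`. -/
def bernWeight {R : Type*} [CommRing R] (P : Finset ℕ) (d : ℕ → R) (A : Finset ℕ) : R :=
  (∏ p ∈ A, d p) * ∏ p ∈ P \ A, (1 - d p)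

lemma sum_bernWeight_mul_prod {R : Type*} [CommRing R] (P : Finset ℕ) (d u v : ℕ → R) :
    ∑ A ∈ P.powerset, bernWeight P d A * ∏ p ∈ P, (if p ∈ A then u p else v p) =
      ∏ p ∈ P, (d p * u p + (1 - d p) * v p) := by
  rw [prod_add]
  refine sum_congr rfl fun A hA => ?_
  rw [mem_powerset] at hA
  rw [bernWeight, ← prod_sdiff hA, prod_mul_distrib, prod_mul_distrib,
    prod_congr rfl fun p (hp : p ∈ P \ A) => if_neg (mem_sdiff.1 hp).2,
    prod_congr rfl fun p (hp : p ∈ A) => if_pos hp]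
  ring

lemma bernWeight_nonneg {P : Finset ℕ} {d : ℕ → ℝ} (h0 : ∀ p, 0 ≤ d p) (h1 : ∀ p, d p ≤ 1)
    (A : Finset ℕ) : 0 ≤ bernWeight P d A :=
  mul_nonneg (prod_nonneg fun p _ => h0 p) (prod_nonneg fun p _ => sub_nonneg.2 (h1 p))

lemma sum_bernWeight_mul_subset {P U : Finset ℕ} (hU : U ⊆ P) (d : ℕ → ℝ) :
    ∑ A ∈ P.powerset, bernWeight P d A * propInd (∀ p ∈ U, p ∈ A) = ∏ p ∈ U, d p := by
  have h := sum_bernWeight_mul_prod P d (fun _ => 1) (fun p => if p ∈ U then 0 else 1)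
  have h2 : ∏ p ∈ P, (d p * 1 + (1 - d p) * (if p ∈ U then 0 else 1)) = ∏ p ∈ U, d p := by
    rw [← prod_sdiff hU, prod_eq_one, one_mul]
    · exact prod_congr rfl fun p hp => by simp [hp]
    · intro p hp
      simp [(mem_sdiff.1 hp).2]
  rw [← h2, ← h]
  refine sum_congr rfl fun A _ => ?_
  congr 1
  unfold propInd
  split_ifs with hA
  · exact (prod_eq_one fun p _ => by
      by_cases hp : p ∈ A
      · simp [hp]
      · have : p ∉ U := fun h => hp (hA p h)
        simp [hp, this]).symm
  · push Not at hA
    obtain ⟨p, hpU, hpA⟩ := hA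
    exact (prod_eq_zero (hU hpU) (by simp [hpU, hpA])).symm

/-- Moments of a counting variable, expanded over tuples of indices. -/
lemma sum_mul_card_filter_pow {α : Type*} (s : Finset α) (w : α → ℝ) (P : Finset ℕ)
    (I : α → ℕ → Prop) (j : ℕ) :
    ∑ a ∈ s, w a * (#{p ∈ P | I a p} : ℝ) ^ j =
      ∑ f ∈ Fintype.piFinset fun _ : Fin j => P,
        ∑ a ∈ s, w a * propInd (∀ p ∈ univ.image f, I a p) := by
  rw [sum_comm]
  refine sum_congr rfl fun a _ => ?_
  rw [← mul_sum]
  congr 1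
  have h : (#{p ∈ P | I a p} : ℝ) ^ j =
      ∏ _i : Fin j, ∑ p ∈ P, (if I a p then (1 : ℝ) else 0) := by
    simp
  rw [h, prod_univ_sum]
  refine sum_congr rfl fun f _ => ?_
  unfold propInd
  split_ifs with hf
  · exact prod_eq_one fun i _ => if_pos (hf _ (by simp))
  · push Not at hf
    obtain ⟨p, hp, hpI⟩ := hf
    obtain ⟨i, -, rfl⟩ := mem_image.1 hp
    exact prod_eq_zero (mem_univ i) (if_neg hpI)

/-- Two counting variables with close joint probabilities have close moments. -/
lemma abs_moment_sub_le {α β : Type*} (s : Finset α) (s' : Finset β) (w : α → ℝ) (w' : β → ℝ)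
    (P : Finset ℕ) (I : α → ℕ → Prop) (J : β → ℕ → Prop) {k : ℕ} {ε : ℝ}
    (h : ∀ U ⊆ P, #U ≤ k → |∑ a ∈ s, w a * propInd (∀ p ∈ U, I a p) -
      ∑ b ∈ s', w' b * propInd (∀ p ∈ U, J b p)| ≤ ε) {j : ℕ} (hj : j ≤ k) :
    |∑ a ∈ s, w a * (#{p ∈ P | I a p} : ℝ) ^ j -
      ∑ b ∈ s', w' b * (#{p ∈ P | J b p} : ℝ) ^ j| ≤ #P ^ j * ε := by
  rw [sum_mul_card_filter_pow, sum_mul_card_filter_pow, ← sum_sub_distrib, ← Real.norm_eq_abs]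
  refine (norm_sum_le _ _).trans ?_
  have hc : (#P : ℝ) ^ j * ε = ∑ f ∈ Fintype.piFinset fun _ : Fin j => P, ε := by
    simp [Fintype.card_piFinset]
  rw [hc]
  refine sum_le_sum fun f hf => ?_
  rw [Real.norm_eq_abs]
  refine h (univ.image f) ?_ ?_
  · intro p hp
    obtain ⟨i, -, rfl⟩ := mem_image.1 hp
    exact Fintype.mem_piFinset.1 hf i
  · refine card_image_le.trans ?_
    rw [card_univ, Fintype.card_fin]
    exact hj

/-- Closeness of moments is preserved by an affine normalization. -/
lemma abs_affine_moment_sub_le {α β : Type*} (s : Finset α) (s' : Finset β) (w : α → ℝ)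
    (w' : β → ℝ) (X : α → ℝ) (Y : β → ℝ) {k : ℕ} {m ε σ c : ℝ} (hσ : 0 < σ)
    (h : ∀ j ≤ k, |∑ a ∈ s, w a * X a ^ j - ∑ b ∈ s', w' b * Y b ^ j| ≤ m ^ j * ε) :
    |∑ a ∈ s, w a * ((X a - c) / σ) ^ k - ∑ b ∈ s', w' b * ((Y b - c) / σ) ^ k| ≤
      ((m + |c|) / σ) ^ k * ε := by
  have e {γ : Type _} (u : Finset γ) (v : γ → ℝ) (T : γ → ℝ) :
      ∑ a ∈ u, v a * ((T a - c) / σ) ^ k =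
        ∑ j ∈ range (k + 1), (σ ^ k)⁻¹ * ((-c) ^ (k - j) * k.choose j) *
          ∑ a ∈ u, v a * T a ^ j := by
    simp_rw [mul_sum]
    rw [sum_comm]
    refine sum_congr rfl fun a _ => ?_
    rw [div_pow, sub_eq_add_neg, add_pow, div_eq_inv_mul, mul_sum, mul_sum]
    exact sum_congr rfl fun j _ => by ring
  have e1 := e (s.disjSum s') (Sum.elim w 0) (Sum.elim X 0)
  have e2 := e (s.disjSum s') (Sum.elim 0 w') (Sum.elim 0 Y)
  simp only [sum_disjSum, Sum.elim_inl, Sum.elim_inr, Pi.zero_apply, zero_mul, sum_const_zero,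
    add_zero, zero_add] at e1 e2
  rw [e1, e2, ← sum_sub_distrib]
  refine (abs_sum_le_sum_abs _ _).trans ?_
  rw [div_pow, add_pow, div_eq_inv_mul, mul_sum, sum_mul]
  refine sum_le_sum fun j hj => ?_
  rw [← mul_sub, abs_mul, abs_mul, abs_mul, abs_pow, abs_neg,
    abs_of_nonneg (by positivity : 0 ≤ (σ ^ k)⁻¹),
    abs_of_nonneg (by positivity : (0 : ℝ) ≤ (k.choose j : ℝ))]
  refine (mul_le_mul_of_nonneg_left (h j (by simpa [Nat.lt_succ_iff] using hj))
    (by positivity)).trans (le_of_eq ?_)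
  ring

lemma bernoulli_exp_le {d δ u : ℝ} (hd0 : 0 ≤ d) (hd1 : d ≤ 1) (hδ0 : 0 ≤ δ) (hδ1 : δ ≤ 1)
    (hu : |u| ≤ 1) :
    d * Real.exp (u * (1 - δ)) + (1 - d) * Real.exp (u * (-δ)) ≤
      Real.exp (|u| * |d - δ| + u ^ 2) := by
  have key (v : ℝ) (hv : |v| ≤ 1) : Real.exp (u * v) ≤ 1 + u * v + u ^ 2 := by
    have hv' : |u * v| ≤ 1 := by
      rw [abs_mul]; exact mul_le_one₀ hu (abs_nonneg _) hv
    have h := (abs_le.1 (Real.abs_exp_sub_one_sub_id_le hv')).2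
    have : v ^ 2 ≤ 1 := (sq_le_one_iff_abs_le_one v).2 hv
    nlinarith [sq_nonneg u]
  have h1 := mul_le_mul_of_nonneg_left
    (key (1 - δ) (abs_le.2 ⟨by linarith, by linarith⟩)) hd0
  have h2 := mul_le_mul_of_nonneg_left
    (key (-δ) (abs_le.2 ⟨by linarith, by linarith⟩)) (sub_nonneg.2 hd1)
  have h3 : u * (d - δ) ≤ |u| * |d - δ| := by
    rw [← abs_mul]; exact le_abs_self _
  have h4 := Real.add_one_le_exp (|u| * |d - δ| + u ^ 2)
  nlinarith

lemma norm_prod_sub_prod_le_sum {ι 𝕜 : Type*} [NormedField 𝕜] (P : Finset ι) (z v : ι → 𝕜)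
    (hz : ∀ i ∈ P, ‖z i‖ ≤ 1) (hv : ∀ i ∈ P, ‖v i‖ ≤ 1) :
    ‖∏ i ∈ P, z i - ∏ i ∈ P, v i‖ ≤ ∑ i ∈ P, ‖z i - v i‖ := by
  induction P using Finset.induction_on with
  | empty => simp
  | insert a P ha ih =>
    rw [prod_insert ha, prod_insert ha, sum_insert ha]
    have h1 := ih (fun i hi => hz i (mem_insert_of_mem hi))
      (fun i hi => hv i (mem_insert_of_mem hi))
    have h2 : ‖∏ i ∈ P, v i‖ ≤ 1 := by
      rw [norm_prod]
      exact prod_le_one (fun _ _ => norm_nonneg _) fun i hi => hv i (mem_insert_of_mem hi)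
    have h3 := hz a (mem_insert_self a P)
    have e : z a * ∏ i ∈ P, z i - v a * ∏ i ∈ P, v i =
        z a * (∏ i ∈ P, z i - ∏ i ∈ P, v i) + (z a - v a) * ∏ i ∈ P, v i := by ring
    rw [e]
    refine (norm_add_le _ _).trans ?_
    rw [norm_mul, norm_mul, add_comm]
    refine add_le_add (mul_le_of_le_one_right (norm_nonneg _) h2)
      ((mul_le_of_le_one_left (norm_nonneg _) h3).trans h1)

/-- The characteristic function at `u` of a centered Bernoulli variable, the success probability
being `d` and the centering `δ`. -/
def bernChar (d δ u : ℝ) : ℂ :=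
  d * Complex.exp ((u * (1 - δ) : ℝ) * Complex.I) +
    (1 - d) * Complex.exp ((u * (-δ) : ℝ) * Complex.I)

lemma norm_bernChar_le_one {d δ u : ℝ} (hd0 : 0 ≤ d) (hd1 : d ≤ 1) : ‖bernChar d δ u‖ ≤ 1 := by
  refine (norm_add_le _ _).trans ?_
  rw [norm_mul, norm_mul, Complex.norm_exp_ofReal_mul_I, Complex.norm_exp_ofReal_mul_I,
    ← Complex.ofReal_one, ← Complex.ofReal_sub, Complex.norm_real, Complex.norm_real,
    Real.norm_of_nonneg hd0, Real.norm_of_nonneg (sub_nonneg.2 hd1)]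
  linarith

lemma norm_bernChar_sub_le (d δ u : ℝ) : ‖bernChar d δ u - bernChar δ δ u‖ ≤ |u| * |d - δ| := by
  have e : bernChar d δ u - bernChar δ δ u = ((d - δ : ℝ) : ℂ) *
      (Complex.exp ((u * (-δ) : ℝ) * Complex.I) * (Complex.exp (Complex.I * (u : ℝ)) - 1)) := by
    have : Complex.exp ((u * (1 - δ) : ℝ) * Complex.I) =
        Complex.exp ((u * (-δ) : ℝ) * Complex.I) * Complex.exp (Complex.I * (u : ℝ)) := by
      rw [← Complex.exp_add]; congr 1; push_cast; ring
    rw [bernChar, bernChar, this]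
    push_cast
    ring
  rw [e, norm_mul, norm_mul, Complex.norm_exp_ofReal_mul_I, Complex.norm_real, one_mul, mul_comm]
  exact mul_le_mul_of_nonneg_right Real.norm_exp_I_mul_ofReal_sub_one_le (abs_nonneg _)

open MeasureTheory ProbabilityTheory in
lemma tendsto_bernChar_pow {δ : ℝ} (h0 : 0 < δ) (h1 : δ < 1) (t : ℝ) :
    Tendsto (fun m : ℕ => bernChar δ δ (t / (√(δ - δ ^ 2) * √m)) ^ m) atTop
      (nhds (Complex.exp (-t ^ 2 / 2))) := by
  have hv : 0 < δ - δ ^ 2 := by nlinarith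
  set σ := √(δ - δ ^ 2) with hσ
  have hσ0 : 0 < σ := Real.sqrt_pos.2 hv
  have hσ2 : σ ^ 2 = δ - δ ^ 2 := Real.sq_sqrt hv.le
  let μ : Measure ℝ := ENNReal.ofReal δ • Measure.dirac ((1 - δ) / σ) +
    ENNReal.ofReal (1 - δ) • Measure.dirac (-δ / σ)
  have h_int {E : Type} [NormedAddCommGroup E] [NormedSpace ℝ E] [CompleteSpace E] (g : ℝ → E) :
      ∫ y, g y ∂μ = δ • g ((1 - δ) / σ) + (1 - δ) • g (-δ / σ) := by
    have hi (y : ℝ) (c : ℝ) : Integrable g (ENNReal.ofReal c • Measure.dirac y) :=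
      (integrable_dirac (by simp [enorm_lt_top])).smul_measure (by simp)
    rw [integral_add_measure (hi _ _) (hi _ _), integral_smul_measure, integral_smul_measure,
      integral_dirac, integral_dirac, ENNReal.toReal_ofReal h0.le,
      ENNReal.toReal_ofReal (sub_nonneg.2 h1.le)]
  have hμ : IsProbabilityMeasure μ := by
    constructor
    simp only [μ, Measure.add_apply, Measure.smul_apply, measure_univ, smul_eq_mul, mul_one]
    rw [← ENNReal.ofReal_add h0.le (sub_nonneg.2 h1.le)]
    simp
  have hlim := tendsto_charFun_inv_sqrt_mul_pow (P := μ) (X := id) aemeasurable_id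
    (by rw [h_int]; simp only [id, smul_eq_mul]; field_simp; ring)
    (by
      rw [h_int]
      have h1' : 1 - δ ≠ 0 := by linarith
      simp only [Pi.pow_apply, id, smul_eq_mul, div_pow, hσ2,
        show δ - δ ^ 2 = δ * (1 - δ) by ring]
      field_simp
      ring) t
  refine hlim.congr fun m => ?_
  rw [Measure.map_id, charFun_apply_real, h_int, bernChar, Complex.real_smul, Complex.real_smul]
  congr 3
  · congr 1
    congr 1
    push_cast
    field_simp
  · push_cast; rfl
  · congr 1
    push_cast
    field_simp

lemma card_sub_eq_sum {P A : Finset ℕ} (hA : A ⊆ P) (δ u : ℝ) :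
    u * (#A - δ * #P) = ∑ p ∈ P, (if p ∈ A then u * (1 - δ) else u * (-δ)) := by
  rw [← sum_sdiff hA, sum_congr rfl fun p (hp : p ∈ P \ A) => if_neg (mem_sdiff.1 hp).2,
    sum_congr rfl fun p (hp : p ∈ A) => if_pos hp]
  simp only [sum_const, nsmul_eq_mul]
  rw [cast_card_sdiff hA]
  ring

lemma sum_bernWeight_mul_exp (P : Finset ℕ) (d : ℕ → ℝ) (δ u : ℝ) :
    ∑ A ∈ P.powerset, bernWeight P d A * Real.exp (u * (#A - δ * #P)) =
      ∏ p ∈ P, (d p * Real.exp (u * (1 - δ)) + (1 - d p) * Real.exp (u * (-δ))) := by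
  rw [← sum_bernWeight_mul_prod]
  refine sum_congr rfl fun A hA => ?_
  rw [card_sub_eq_sum (mem_powerset.1 hA), Real.exp_sum]
  exact congrArg _ (prod_congr rfl fun p _ => apply_ite _ _ _ _)

lemma sum_bernWeight_mul_cexp (P : Finset ℕ) (d : ℕ → ℝ) (δ u : ℝ) :
    ∑ A ∈ P.powerset, ((bernWeight P d A : ℝ) : ℂ) *
      Complex.exp ((u * (#A - δ * #P) : ℝ) * Complex.I) = ∏ p ∈ P, bernChar (d p) δ u := by
  have h := sum_bernWeight_mul_prod P (fun p => (d p : ℂ))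
    (fun _ => Complex.exp ((u * (1 - δ) : ℝ) * Complex.I))
    (fun _ => Complex.exp ((u * (-δ) : ℝ) * Complex.I))
  simp only [bernChar]
  rw [← h]
  refine sum_congr rfl fun A hA => ?_
  rw [card_sub_eq_sum (mem_powerset.1 hA), Complex.ofReal_sum, sum_mul, Complex.exp_sum]
  congr 1
  · simp [bernWeight]
  · exact prod_congr rfl fun p _ => by split_ifs <;> rfl

/-- The characteristic functions of normalized sums of independent Bernoulli variables with
success probabilities close to `δ` converge to that of the standard Gaussian. -/
lemma tendsto_sum_bernWeight_mul_cexp (P : ℕ → Finset ℕ) (d : ℕ → ℝ) (hd0 : ∀ p, 0 ≤ d p)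
    (hd1 : ∀ p, d p ≤ 1) {δ : ℝ} (h0 : 0 < δ) (h1 : δ < 1)
    (hP : Tendsto (fun N => #(P N)) atTop atTop)
    (hd : Tendsto (fun N => (∑ p ∈ P N, |d p - δ|) / √(#(P N) : ℝ)) atTop (nhds 0)) (t : ℝ) :
    Tendsto (fun N => ∑ A ∈ (P N).powerset, ((bernWeight (P N) d A : ℝ) : ℂ) *
      Complex.exp ((t * ((#A - δ * #(P N)) / (√(δ - δ ^ 2) * √(#(P N) : ℝ))) : ℝ) * Complex.I))
      atTop (nhds (Complex.exp (-t ^ 2 / 2))) := by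
  have hmain := (tendsto_bernChar_pow h0 h1 t).comp hP
  set u : ℕ → ℝ := fun N => t / (√(δ - δ ^ 2) * √(#(P N) : ℝ)) with hu
  have hdiff : Tendsto (fun N => ∏ p ∈ P N, bernChar (d p) δ (u N) -
      bernChar δ δ (u N) ^ #(P N)) atTop (nhds 0) := by
    have hb : Tendsto (fun N => |t| / √(δ - δ ^ 2) * ((∑ p ∈ P N, |d p - δ|) / √(#(P N) : ℝ)))
        atTop (nhds 0) := by
      simpa using hd.const_mul (|t| / √(δ - δ ^ 2))
    refine squeeze_zero_norm (fun N => ?_) hb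
    rw [← prod_const]
    refine (norm_prod_sub_prod_le_sum _ _ _ (fun p _ => norm_bernChar_le_one (hd0 p) (hd1 p))
      (fun p _ => norm_bernChar_le_one h0.le h1.le)).trans ?_
    refine (sum_le_sum fun p _ => norm_bernChar_sub_le (d p) δ (u N)).trans (le_of_eq ?_)
    rw [← mul_sum]
    simp only [hu, abs_div, abs_mul, abs_of_nonneg (Real.sqrt_nonneg _)]
    ring
  have h := hdiff.add hmain
  simp only [zero_add] at h
  refine h.congr fun N => ?_
  simp only [Function.comp_apply]
  have e (A : Finset ℕ) : t * ((#A - δ * #(P N)) / (√(δ - δ ^ 2) * √(#(P N) : ℝ))) =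
      u N * (#A - δ * #(P N)) := by
    simp only [hu]; ring
  simp_rw [e]
  rw [sum_bernWeight_mul_cexp]
  simp only [hu]
  ring

/-- Exponential moments of normalized sums of independent Bernoulli variables are bounded. -/
lemma exists_sum_bernWeight_mul_exp_le (P : ℕ → Finset ℕ) (d : ℕ → ℝ) (hd0 : ∀ p, 0 ≤ d p)
    (hd1 : ∀ p, d p ≤ 1) {δ : ℝ} (h0 : 0 < δ) (h1 : δ < 1)
    (hP : Tendsto (fun N => #(P N)) atTop atTop)
    (hd : Tendsto (fun N => (∑ p ∈ P N, |d p - δ|) / √(#(P N) : ℝ)) atTop (nhds 0)) (l : ℝ) :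
    ∃ B : ℝ, ∀ᶠ N in atTop, ∑ A ∈ (P N).powerset, bernWeight (P N) d A *
      Real.exp (l * ((#A - δ * #(P N)) / (√(δ - δ ^ 2) * √(#(P N) : ℝ)))) ≤ B := by
  have hv : 0 < δ - δ ^ 2 := by nlinarith
  have hσ0 : 0 < √(δ - δ ^ 2) := Real.sqrt_pos.2 hv
  set u : ℕ → ℝ := fun N => l / (√(δ - δ ^ 2) * √(#(P N) : ℝ)) with hu
  have hsqrt : Tendsto (fun N => √(#(P N) : ℝ)) atTop atTop :=
    Real.tendsto_sqrt_atTop.comp (tendsto_natCast_atTop_atTop.comp hP)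
  have hu0 : Tendsto u atTop (nhds 0) :=
    Tendsto.div_atTop tendsto_const_nhds (hsqrt.const_mul_atTop hσ0)
  refine ⟨Real.exp (|l| / √(δ - δ ^ 2) + l ^ 2 / (δ - δ ^ 2)), ?_⟩
  filter_upwards [hu0.abs.eventually (gt_mem_nhds (by simp : |(0 : ℝ)| < 1)),
    hd.eventually (gt_mem_nhds one_pos), hP.eventually (eventually_gt_atTop 0)] with N h2 h3 h4
  have e (A : Finset ℕ) : l * ((#A - δ * #(P N)) / (√(δ - δ ^ 2) * √(#(P N) : ℝ))) =
      u N * (#A - δ * #(P N)) := by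
    simp only [hu]; ring
  simp_rw [e]
  rw [sum_bernWeight_mul_exp]
  have hm : 0 < (#(P N) : ℝ) := by exact_mod_cast h4
  calc ∏ p ∈ P N, (d p * Real.exp (u N * (1 - δ)) + (1 - d p) * Real.exp (u N * (-δ)))
      ≤ ∏ p ∈ P N, Real.exp (|u N| * |d p - δ| + u N ^ 2) := by
        refine prod_le_prod (fun p _ => ?_) fun p _ =>
          bernoulli_exp_le (hd0 p) (hd1 p) h0.le h1.le h2.le
        have := hd0 p
        have := sub_nonneg.2 (hd1 p)
        positivity
    _ = Real.exp (|l| / √(δ - δ ^ 2) * ((∑ p ∈ P N, |d p - δ|) / √(#(P N) : ℝ)) +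
          l ^ 2 / (δ - δ ^ 2)) := by
        rw [← Real.exp_sum, sum_add_distrib, ← mul_sum, sum_const, nsmul_eq_mul]
        simp only [hu, abs_div, abs_mul, abs_of_nonneg (Real.sqrt_nonneg _), div_pow, mul_pow,
          Real.sq_sqrt hv.le, Real.sq_sqrt hm.le]
        congr 2
        · ring
        · field_simp
    _ ≤ Real.exp (|l| / √(δ - δ ^ 2) + l ^ 2 / (δ - δ ^ 2)) := by
        gcongr
        exact mul_le_of_le_one_right (by positivity) h3.le

/-- A central limit theorem for counting variables on finite probability spaces, the joint
probabilities of the events counted being asymptotically those of independent events. -/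
theorem tendsto_card_filter_div_gaussian {α : Type*} (s : ℕ → Finset α)
    (hs : ∀ N, (s N).Nonempty) (P : ℕ → Finset ℕ) (I : α → ℕ → Prop) (d : ℕ → ℝ)
    (hd0 : ∀ p, 0 ≤ d p) (hd1 : ∀ p, d p ≤ 1) {δ : ℝ} (h0 : 0 < δ) (h1 : δ < 1)
    (hP : Tendsto (fun N => #(P N)) atTop atTop)
    (hd : Tendsto (fun N => (∑ p ∈ P N, |d p - δ|) / √(#(P N) : ℝ)) atTop (nhds 0))
    (hjoint : ∀ k : ℕ, ∃ ε : ℕ → ℝ, (∀ᶠ N in atTop, ∀ U ⊆ P N, #U ≤ k →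
      |(#{a ∈ s N | ∀ p ∈ U, I a p} : ℝ) / #(s N) - ∏ p ∈ U, d p| ≤ ε N) ∧
      Tendsto (fun N => (#(P N) : ℝ) ^ k * ε N) atTop (nhds 0)) {a b : ℝ} (hab : a < b) :
    Tendsto (fun N => (#{f ∈ s N |
        a ≤ ((#{p ∈ P N | I f p} : ℝ) - δ * #(P N)) / (√(δ - δ ^ 2) * √(#(P N) : ℝ)) ∧
        ((#{p ∈ P N | I f p} : ℝ) - δ * #(P N)) / (√(δ - δ ^ 2) * √(#(P N) : ℝ)) ≤ b} : ℝ) /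
          #(s N)) atTop
      (nhds ((1 / Real.sqrt (2 * Real.pi)) * ∫ t in a..b, Real.exp (-t ^ 2 / 2))) := by
  have hv : 0 < δ - δ ^ 2 := by nlinarith
  have hσ0 : 0 < √(δ - δ ^ 2) := Real.sqrt_pos.2 hv
  have hsqrt : Tendsto (fun N => √(#(P N) : ℝ)) atTop atTop :=
    Real.tendsto_sqrt_atTop.comp (tendsto_natCast_atTop_atTop.comp hP)
  refine tendsto_card_filter_div_of_charSum s hs (fun N f =>
    ((#{p ∈ P N | I f p} : ℝ) - δ * #(P N)) / (√(δ - δ ^ 2) * √(#(P N) : ℝ))) (fun t => ?_) hab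
  have hcmp := tendsto_charSum_sub s (fun N => (P N).powerset) (fun N _ => (#(s N) : ℝ)⁻¹)
    (fun N => bernWeight (P N) d) (fun N _ _ => by positivity)
    (fun N A _ => bernWeight_nonneg hd0 hd1 A)
    (fun N f => ((#{p ∈ P N | I f p} : ℝ) - δ * #(P N)) / (√(δ - δ ^ 2) * √(#(P N) : ℝ)))
    (fun N A => ((#A : ℝ) - δ * #(P N)) / (√(δ - δ ^ 2) * √(#(P N) : ℝ))) ?_
    (exists_sum_bernWeight_mul_exp_le P d hd0 hd1 h0 h1 hP hd) t
  · have h := hcmp.add (tendsto_sum_bernWeight_mul_cexp P d hd0 hd1 h0 h1 hP hd t)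
    simpa only [sub_add_cancel, zero_add] using h
  · intro k
    obtain ⟨ε, hε, hε0⟩ := hjoint k
    have hlim : Tendsto (fun N => (1 + |δ|) ^ k * ((#(P N) : ℝ) ^ k * ε N)) atTop (nhds 0) := by
      simpa using hε0.const_mul ((1 + |δ|) ^ k)
    refine squeeze_zero_norm' ?_ hlim
    filter_upwards [hε, (hsqrt.const_mul_atTop hσ0).eventually (eventually_ge_atTop 1)]
      with N hN hσ1
    have hε_nonneg : 0 ≤ ε N := (abs_nonneg _).trans (hN ∅ (by simp) (by simp))
    have hmom : ∀ j ≤ k, |∑ f ∈ s N, (#(s N) : ℝ)⁻¹ * (#{p ∈ P N | I f p} : ℝ) ^ j -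
        ∑ A ∈ (P N).powerset, bernWeight (P N) d A * (#A : ℝ) ^ j| ≤
          (#(P N) : ℝ) ^ j * ε N := by
      intro j hj
      have hj' := abs_moment_sub_le (ε := ε N) (s N) (P N).powerset (fun _ => (#(s N) : ℝ)⁻¹)
        (bernWeight (P N) d) (P N) I (fun A p => p ∈ A) (fun U hU hUk => ?_) hj
      · have e : ∑ A ∈ (P N).powerset, bernWeight (P N) d A * (#A : ℝ) ^ j =
            ∑ A ∈ (P N).powerset, bernWeight (P N) d A * (#{p ∈ P N | p ∈ A} : ℝ) ^ j := by
          refine sum_congr rfl fun A hA => ?_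
          rw [filter_mem_eq_inter, inter_eq_right.2 (mem_powerset.1 hA)]
        rw [e]
        convert! hj'
      · rw [sum_bernWeight_mul_subset hU]
        convert! hN U hU hUk using 3
        rw [← mul_sum, card_filter, div_eq_inv_mul]
        push_cast
        refine congrArg _ (sum_congr rfl fun f _ => ?_)
        unfold propInd
        split_ifs <;> rfl
    have h := abs_affine_moment_sub_le (c := δ * #(P N)) (s N) (P N).powerset
      (fun _ => (#(s N) : ℝ)⁻¹) (bernWeight (P N) d) (fun f => (#{p ∈ P N | I f p} : ℝ))
      (fun A => (#A : ℝ)) (zero_lt_one.trans_le hσ1) hmom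
    rw [Real.norm_eq_abs]
    refine h.trans ?_
    rw [← mul_assoc, ← mul_pow, abs_mul, Nat.abs_cast]
    refine mul_le_mul_of_nonneg_right (pow_le_pow_left₀ (by positivity) ?_ k) hε_nonneg
    rw [← one_add_mul]
    exact div_le_self (by positivity) hσ1

/-- The monic polynomial of degree `n` with lower coefficients `v`. -/
def monicPoly {R : Type*} [CommRing R] (n : ℕ) (v : Fin n → R) : R[X] :=
  X ^ n + ∑ i : Fin n, C (v i) * X ^ (i : ℕ)

section MonicPoly

variable {R : Type*} [CommRing R]

lemma intPoly_eq_monicPoly (n : ℕ) (a : Fin n → ℤ) : intPoly n a = monicPoly n a := rfl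

lemma map_monicPoly {S : Type*} [CommRing S] (φ : R →+* S) (n : ℕ) (v : Fin n → R) :
    (monicPoly n v).map φ = monicPoly n (fun i => φ (v i)) := by
  simp [monicPoly, Polynomial.map_sum]

lemma degree_sum_C_mul_X_pow_lt (n : ℕ) (v : Fin n → R) :
    (∑ i : Fin n, C (v i) * X ^ (i : ℕ)).degree < (n : WithBot ℕ) := by
  refine (degree_sum_le _ _).trans_lt ?_
  rw [Finset.sup_lt_iff (by exact_mod_cast WithBot.bot_lt_coe n)]
  exact fun i _ => (degree_C_mul_X_pow_le _ _).trans_lt (by exact_mod_cast i.2)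

lemma monic_monicPoly (n : ℕ) (v : Fin n → R) : (monicPoly n v).Monic :=
  monic_X_pow_add (degree_sum_C_mul_X_pow_lt n v)

lemma natDegree_monicPoly [Nontrivial R] (n : ℕ) (v : Fin n → R) :
    (monicPoly n v).natDegree = n := by
  rw [monicPoly, natDegree_add_eq_left_of_degree_lt, natDegree_X_pow]
  rw [degree_X_pow]
  exact degree_sum_C_mul_X_pow_lt n v

lemma coeff_monicPoly (n : ℕ) (v : Fin n → R) (i : Fin n) : (monicPoly n v).coeff i = v i := by
  simp only [monicPoly, coeff_add, coeff_X_pow, finsetSum_coeff, coeff_C_mul]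
  rw [if_neg i.2.ne, sum_eq_single i] <;> simp +contextual [Fin.val_inj, eq_comm]

lemma monicPoly_injective (n : ℕ) : Function.Injective (monicPoly (R := R) n) := fun v w h =>
  funext fun i => by rw [← coeff_monicPoly n v, h, coeff_monicPoly]

lemma monicPoly_coeff {n : ℕ} {g : R[X]} (hg : g.Monic) (hn : g.natDegree = n) :
    monicPoly n (fun i => g.coeff i) = g := by
  conv_rhs => rw [hg.as_sum, hn, ← Fin.sum_univ_eq_sum_range (fun i => C (g.coeff i) * X ^ i)]
  rfl

end MonicPoly

/-- The monic irreducible polynomials of degree `d` over `𝔽_p`. -/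
def monicIrreducibles (p d : ℕ) [Fact p.Prime] : Finset (ZMod p)[X] :=
  (univ.image (monicPoly d)).filter Irreducible

lemma mem_monicIrreducibles {p d : ℕ} [Fact p.Prime] {h : (ZMod p)[X]} :
    h ∈ monicIrreducibles p d ↔ h.Monic ∧ Irreducible h ∧ h.natDegree = d := by
  simp only [monicIrreducibles, mem_filter, mem_image, mem_univ, true_and]
  constructor
  · rintro ⟨⟨v, rfl⟩, h⟩
    exact ⟨monic_monicPoly d v, h, natDegree_monicPoly d v⟩
  · rintro ⟨h1, h2, h3⟩
    exact ⟨⟨_, monicPoly_coeff h1 h3⟩, h2⟩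

section Count

variable (p : ℕ) [hp : Fact p.Prime] (K : Type*) [Field K] [Fintype K] [Algebra (ZMod p) K]

lemma card_filter_minpoly_eq_of_splits {d : ℕ} {h : (ZMod p)[X]} (hh : h ∈ monicIrreducibles p d)
    (hsplit : Splits (h.map (algebraMap (ZMod p) K))) :
    #{α : K | minpoly (ZMod p) α = h} = d := by
  obtain ⟨hm, hi, hdeg⟩ := mem_monicIrreducibles.1 hh
  have hcard := card_rootSet_eq_natDegree (PerfectField.separable_of_irreducible hi) hsplit
  rw [hdeg] at hcard
  rw [← Fintype.card_subtype, ← hcard]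
  refine Fintype.card_congr (Equiv.subtypeEquivRight fun α => ?_)
  rw [mem_rootSet, and_iff_right hi.ne_zero]
  constructor
  · rintro rfl
    exact minpoly.aeval _ _
  · intro h0
    exact (minpoly.eq_of_irreducible_of_monic hi h0 hm).symm

lemma card_filter_minpoly_eq {d : ℕ} (hd : d ≠ 0) (hK : Fintype.card K = p ^ d)
    {h : (ZMod p)[X]} (hh : h ∈ monicIrreducibles p d) :
    #{α : K | minpoly (ZMod p) α = h} = d := by
  obtain ⟨-, hi, hdeg⟩ := mem_monicIrreducibles.1 hh
  refine card_filter_minpoly_eq_of_splits p K hh ?_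
  have h1 : h ∣ X ^ (Nat.card (ZMod p)) ^ d - X :=
    hi.natDegree_dvd_iff_dvd_X_pow_card_pow_sub_X.1 hdeg.dvd
  have h2 : Splits ((X ^ p ^ d - X : (ZMod p)[X]).map (algebraMap (ZMod p) K)) :=
    (FiniteField.isSplittingField_of_card_eq _ _ hK).splits
  rw [Nat.card_zmod] at h1
  refine Splits.of_dvd h2 ?_ (Polynomial.map_dvd _ h1)
  exact map_ne_zero (FiniteField.X_pow_card_pow_sub_X_ne_zero _ hd hp.out.one_lt)

lemma card_filter_natDegree_minpoly_eq {d : ℕ} (hd : d ≠ 0) (hK : Fintype.card K = p ^ d) :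
    #{α : K | (minpoly (ZMod p) α).natDegree = d} =
      d * #(monicIrreducibles p d) := by
  rw [mul_comm, ← smul_eq_mul, ← sum_const]
  rw [card_eq_sum_card_fiberwise (f := fun α => minpoly (ZMod p) α) (t := monicIrreducibles p d)]
  · refine sum_congr rfl fun h hh => ?_
    rw [filter_filter]
    refine (congrArg card ?_).trans (card_filter_minpoly_eq p K hd hK hh)
    ext α
    simp only [mem_filter, mem_univ, true_and, and_iff_right_iff_imp]
    rintro rfl
    exact (mem_monicIrreducibles.1 hh).2.2
  · intro α hα
    have h_int := Algebra.IsIntegral.isIntegral (R := ZMod p) α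
    exact mem_monicIrreducibles.2
      ⟨minpoly.monic h_int, minpoly.irreducible h_int, (mem_filter.1 hα).2⟩

lemma card_filter_natDegree_minpoly_le {e : ℕ} (he : e ≠ 0) :
    #{α : K | (minpoly (ZMod p) α).natDegree = e} ≤ p ^ e := by
  have hne := FiniteField.X_pow_card_pow_sub_X_ne_zero (K) he hp.out.one_lt
  calc _ ≤ #(X ^ p ^ e - X : (K)[X]).roots.toFinset := by
        refine card_le_card fun α hα => ?_
        have hi := minpoly.irreducible (Algebra.IsIntegral.isIntegral (R := ZMod p) α)
        have h1 := hi.natDegree_dvd_iff_dvd_X_pow_card_pow_sub_X.1 (mem_filter.1 hα).2.dvd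
        rw [Nat.card_zmod] at h1
        have h2 : aeval α (X ^ p ^ e - X : (ZMod p)[X]) = 0 :=
          aeval_eq_zero_of_dvd_aeval_eq_zero h1 (minpoly.aeval _ α)
        rw [Multiset.mem_toFinset, mem_roots hne]
        simpa using h2
    _ ≤ _ := (Multiset.toFinset_card_le _).trans (card_roots' _)
    _ = p ^ e := FiniteField.X_pow_card_pow_sub_X_natDegree_eq _ he hp.out.one_lt

lemma mul_card_monicIrreducibles_le {d : ℕ} (hd : d ≠ 0) :
    d * #(monicIrreducibles p d) ≤ p ^ d := by
  have : Fintype (GaloisField p d) := Fintype.ofFinite _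
  have hcard : Fintype.card (GaloisField p d) = p ^ d := by
    rw [← Nat.card_eq_fintype_card, GaloisField.card p d hd]
  rw [← card_filter_natDegree_minpoly_eq p _ hd hcard]
  exact card_filter_natDegree_minpoly_le p _ hd

lemma le_mul_card_monicIrreducibles {d : ℕ} (hd : d ≠ 0) :
    p ^ d ≤ d * #(monicIrreducibles p d) + d * p ^ (d - 1) := by
  have : Fintype (GaloisField p d) := Fintype.ofFinite _
  have hcard : Fintype.card (GaloisField p d) = p ^ d := by
    rw [← Nat.card_eq_fintype_card, GaloisField.card p d hd]
  rw [← hcard, ← card_filter_natDegree_minpoly_eq p _ hd hcard, ← card_univ,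
    ← card_filter_add_card_filter_not
      (fun α : GaloisField p d => (minpoly (ZMod p) α).natDegree = d)]
  refine Nat.add_le_add_left ?_ _
  rw [card_eq_sum_card_fiberwise (f := fun α => (minpoly (ZMod p) α).natDegree) (t := Ico 1 d)]
  · have hle : ∀ e ∈ Ico 1 d, #{α ∈ univ.filter (fun α : GaloisField p d =>
        ¬ (minpoly (ZMod p) α).natDegree = d) | (minpoly (ZMod p) α).natDegree = e} ≤
        p ^ (d - 1) := by
      intro e he
      rw [mem_Ico] at he
      refine (card_le_card ?_).trans ((card_filter_natDegree_minpoly_le p _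
        (e := e) (by omega)).trans (Nat.pow_le_pow_right hp.out.pos (by omega)))
      intro α hα
      simp only [mem_filter, mem_univ, true_and] at hα ⊢
      exact hα.2
    refine (sum_le_card_nsmul _ _ _ hle).trans ?_
    rw [Nat.card_Ico, smul_eq_mul]
    exact Nat.mul_le_mul_right _ (Nat.sub_le _ _)
  · intro α hα
    have h_int := Algebra.IsIntegral.isIntegral (R := ZMod p) α
    have hpos := minpoly.natDegree_pos h_int
    have hle : (minpoly (ZMod p) α).natDegree ≤ d := by
      have := minpoly.natDegree_le (A := ZMod p) α
      rwa [GaloisField.finrank p hd] at this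
    have hne : (minpoly (ZMod p) α).natDegree ≠ d := (mem_filter.1 hα).2
    rw [coe_Ico, Set.mem_Ico]
    dsimp only
    omega

end Count

section IrreducibleProducts

variable {F : Type*} [Field F]

lemma isCoprime_of_monic_irreducible {g h : F[X]} (hg : g.Monic) (hgi : Irreducible g)
    (hh : h.Monic) (hhi : Irreducible h) (hne : g ≠ h) : IsCoprime g h := by
  rw [hgi.coprime_iff_not_dvd]
  exact fun hdvd => hne (eq_of_monic_of_associated hg hh (hgi.associated_of_dvd hhi hdvd))

lemma pairwise_isCoprime_of_monic_irreducible {P : Finset F[X]}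
    (hP : ∀ h ∈ P, h.Monic ∧ Irreducible h) :
    (P : Set F[X]).Pairwise (Function.onFun IsCoprime fun h => h) := fun g hg h hh hne =>
  isCoprime_of_monic_irreducible (hP g hg).1 (hP g hg).2 (hP h hh).1 (hP h hh).2 hne

lemma dvd_prod_iff_mem {P : Finset F[X]} (hP : ∀ h ∈ P, h.Monic ∧ Irreducible h) {g : F[X]}
    (hg : g.Monic) (hgi : Irreducible g) : g ∣ ∏ h ∈ P, h ↔ g ∈ P := by
  refine ⟨fun hdvd => ?_, fun hmem => dvd_prod_of_mem _ hmem⟩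
  obtain ⟨h, hh, hdvd⟩ := (hgi.prime.dvd_finsetProd_iff _).1 hdvd
  rwa [eq_of_monic_of_associated hg (hP h hh).1 (hgi.associated_of_dvd (hP h hh).2 hdvd)]

lemma squarefree_prod_of_monic_irreducible {P : Finset F[X]}
    (hP : ∀ h ∈ P, h.Monic ∧ Irreducible h) : Squarefree (∏ h ∈ P, h) :=
  squarefree_prod_of_pairwise_isCoprime
    (fun _ hg _ hh hne => (pairwise_isCoprime_of_monic_irreducible hP hg hh hne).isRelPrime)
    fun h hh => (hP h hh).2.squarefree

end IrreducibleProducts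

section SplittingTypeCount

variable {p : ℕ} [hp : Fact p.Prime] {n : ℕ}

lemma splitTypeOf_iff {g : (ZMod p)[X]} {r : Fin n → ℕ} : SplitTypeOf g r ↔
    Squarefree g ∧ ∀ i : Fin n, #{h ∈ monicIrreducibles p (i + 1) | h ∣ g} = r i := by
  unfold SplitTypeOf
  refine and_congr_right fun _ => forall_congr' fun i => ?_
  rw [← Fintype.card_coe, ← Nat.card_eq_fintype_card]
  refine Eq.congr_left (Nat.card_congr (Equiv.subtypeEquivRight fun h => ?_))
  rw [mem_filter, mem_monicIrreducibles]
  tauto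

lemma monic_irreducible_of_mem_biUnion {S : Fin n → Finset (ZMod p)[X]}
    (hS : ∀ i : Fin n, S i ⊆ monicIrreducibles p (i + 1)) :
    ∀ h ∈ univ.biUnion S, h.Monic ∧ Irreducible h := by
  intro h hh
  obtain ⟨i, -, hi⟩ := mem_biUnion.1 hh
  have := mem_monicIrreducibles.1 (hS i hi)
  exact ⟨this.1, this.2.1⟩

lemma natDegree_prod_biUnion {S : Fin n → Finset (ZMod p)[X]}
    (hS : ∀ i : Fin n, S i ⊆ monicIrreducibles p (i + 1)) :
    (∏ h ∈ univ.biUnion S, h).natDegree = ∑ i : Fin n, ((i : ℕ) + 1) * #(S i) := by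
  rw [natDegree_prod_of_monic _ _ fun h hh => (monic_irreducible_of_mem_biUnion hS h hh).1,
    sum_biUnion]
  · refine sum_congr rfl fun i _ => ?_
    rw [sum_congr rfl fun h hh => (mem_monicIrreducibles.1 (hS i hh)).2.2, sum_const, smul_eq_mul,
      mul_comm]
  · intro i _ j _ hij
    refine disjoint_left.2 fun h hi hj => hij (Fin.ext ?_)
    have h1 := (mem_monicIrreducibles.1 (hS i hi)).2.2
    have h2 := (mem_monicIrreducibles.1 (hS j hj)).2.2
    omega

/-- A polynomial of full splitting type is the product of its monic irreducible factors. -/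
lemma SplitTypeOf.eq_prod {g : (ZMod p)[X]} {r : Fin n → ℕ} (h : SplitTypeOf g r) (hg : g.Monic)
    (hn : g.natDegree = n) (hr : ∑ i : Fin n, ((i : ℕ) + 1) * r i = n) :
    g = ∏ h ∈ univ.biUnion fun i : Fin n => {h ∈ monicIrreducibles p (i + 1) | h ∣ g}, h := by
  rw [splitTypeOf_iff] at h
  have hS : ∀ i : Fin n, {h ∈ monicIrreducibles p (i + 1) | h ∣ g} ⊆
    monicIrreducibles p (i + 1) := fun i => filter_subset _ _
  have hP := monic_irreducible_of_mem_biUnion hS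
  refine eq_of_monic_of_dvd_of_natDegree_le (monic_prod_of_monic _ _ fun h hh => (hP h hh).1) hg
    (Finset.prod_dvd_of_coprime (pairwise_isCoprime_of_monic_irreducible hP) fun h hh => ?_) ?_
  · obtain ⟨i, -, hi⟩ := mem_biUnion.1 hh
    exact (mem_filter.1 hi).2
  · rw [natDegree_prod_biUnion hS, hn, sum_congr rfl fun i _ => by rw [h.2 i], hr]

/-- The coefficient vectors over `𝔽_p` of the monic polynomials of splitting type `r`. -/
def splitVectors (p : ℕ) [Fact p.Prime] {n : ℕ} (r : Fin n → ℕ) : Finset (Fin n → ZMod p) :=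
  {v | SplitTypeOf (monicPoly n v) r}

lemma card_splitVectors {r : Fin n → ℕ} (hr : ∑ i : Fin n, ((i : ℕ) + 1) * r i = n) :
    #(splitVectors p r) = ∏ i : Fin n, (#(monicIrreducibles p (i + 1))).choose (r i) := by
  have hcard : #(Fintype.piFinset fun i : Fin n =>
      powersetCard (r i) (monicIrreducibles p (i + 1))) =
      ∏ i : Fin n, (#(monicIrreducibles p (i + 1))).choose (r i) := by
    simp [Fintype.card_piFinset]
  rw [← hcard]
  refine card_bij (fun v _ i => {h ∈ monicIrreducibles p (i + 1) | h ∣ monicPoly n v}) ?_ ?_ ?_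
  · intro v hv
    have h := splitTypeOf_iff.1 (mem_filter.1 hv).2
    simp only [Fintype.mem_piFinset, mem_powersetCard]
    exact fun i => ⟨filter_subset _ _, h.2 i⟩
  · intro v hv w hw hvw
    have e1 := (mem_filter.1 hv).2.eq_prod (monic_monicPoly n v) (natDegree_monicPoly n v) hr
    have e2 := (mem_filter.1 hw).2.eq_prod (monic_monicPoly n w) (natDegree_monicPoly n w) hr
    refine monicPoly_injective n ?_
    rw [e1, e2]
    exact congrArg (fun S : Fin n → Finset (ZMod p)[X] => ∏ h ∈ univ.biUnion S, h) hvw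
  · intro S hS
    simp only [Fintype.mem_piFinset, mem_powersetCard] at hS
    have hS1 : ∀ i, S i ⊆ monicIrreducibles p (i + 1) := fun i => (hS i).1
    have hP := monic_irreducible_of_mem_biUnion hS1
    have hmonic := monic_prod_of_monic _ (fun h => h) fun h hh => (hP h hh).1
    have hdeg : (∏ h ∈ univ.biUnion S, h).natDegree = n := by
      rw [natDegree_prod_biUnion hS1, sum_congr rfl fun i _ => by rw [(hS i).2], hr]
    have hfilter : ∀ i : Fin n,
        {h ∈ monicIrreducibles p (i + 1) | h ∣ ∏ h ∈ univ.biUnion S, h} = S i := by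
      intro i
      ext h
      rw [mem_filter]
      constructor
      · rintro ⟨h1, h2⟩
        have h3 := mem_monicIrreducibles.1 h1
        rw [dvd_prod_iff_mem hP h3.1 h3.2.1, mem_biUnion] at h2
        obtain ⟨j, -, hj⟩ := h2
        have h4 := mem_monicIrreducibles.1 (hS1 j hj)
        have hij : i = j := Fin.ext (by omega)
        rwa [hij]
      · intro h1
        exact ⟨hS1 i h1, dvd_prod_of_mem (fun h => h) (mem_biUnion.2 ⟨i, mem_univ _, h1⟩)⟩
    refine ⟨fun i => (∏ h ∈ univ.biUnion S, h).coeff i, ?_, ?_⟩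
    · rw [splitVectors, mem_filter, monicPoly_coeff hmonic hdeg, splitTypeOf_iff]
      refine ⟨mem_univ _, squarefree_prod_of_monic_irreducible hP, fun i => ?_⟩
      rw [hfilter, (hS i).2]
    · funext i
      rw [monicPoly_coeff hmonic hdeg, hfilter]

end SplittingTypeCount

lemma choose_div_eq_prod (p d M k : ℕ) : ((M.choose k : ℕ) : ℝ) / (p : ℝ) ^ (d * k) =
    (1 / (k.factorial : ℝ)) * ∏ j ∈ range k, ((M - j : ℕ) : ℝ) / p ^ d := by
  rw [prod_div_distrib, prod_const, card_range, ← pow_mul, ← Nat.cast_prod,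
    ← Nat.descFactorial_eq_prod_range, Nat.descFactorial_eq_factorial_mul_choose]
  have : (k.factorial : ℝ) ≠ 0 := by exact_mod_cast k.factorial_ne_zero
  push_cast
  field_simp

section LocalDensity

variable (p : ℕ) [hp : Fact p.Prime]

lemma card_monicIrreducibles_div_le {d : ℕ} (hd : d ≠ 0) :
    (#(monicIrreducibles p d) : ℝ) / p ^ d ≤ 1 / d := by
  have hp0 : (0 : ℝ) < p := by exact_mod_cast hp.out.pos
  have hd0 : (0 : ℝ) < d := by exact_mod_cast Nat.pos_of_ne_zero hd
  rw [div_le_div_iff₀ (by positivity) hd0, one_mul, mul_comm]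
  exact_mod_cast mul_card_monicIrreducibles_le p hd

lemma abs_card_monicIrreducibles_sub_div_sub_le {d : ℕ} (hd : d ≠ 0) (j : ℕ) :
    |((#(monicIrreducibles p d) - j : ℕ) : ℝ) / p ^ d - 1 / d| ≤ (1 + j) / p := by
  have hp0 : (0 : ℝ) < p := by exact_mod_cast hp.out.pos
  have hd0 : (0 : ℝ) < d := by exact_mod_cast Nat.pos_of_ne_zero hd
  have hpd : (p : ℝ) ^ d = p * p ^ (d - 1) := by rw [← pow_succ', Nat.sub_add_cancel (by omega)]
  have hpp : (0 : ℝ) < p ^ d := by positivity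
  have hlow : (p : ℝ) ^ d ≤ d * #(monicIrreducibles p d) + d * p ^ (d - 1) := by
    exact_mod_cast le_mul_card_monicIrreducibles p hd
  have hsub : (#(monicIrreducibles p d) : ℝ) - j ≤ ((#(monicIrreducibles p d) - j : ℕ) : ℝ) := by
    rw [sub_le_iff_le_add]
    exact_mod_cast le_tsub_add
  have hone : (1 : ℝ) ≤ p ^ (d - 1) := one_le_pow₀ (by exact_mod_cast hp.out.one_le)
  have h1 : (1 : ℝ) / d - 1 / p ≤ (#(monicIrreducibles p d) : ℝ) / p ^ d := by
    rw [div_sub_div _ _ hd0.ne' hp0.ne', div_le_div_iff₀ (by positivity) hpp, hpd]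
    rw [hpd] at hlow
    nlinarith [mul_le_mul_of_nonneg_left hlow hp0.le]
  have h2 : (j : ℝ) / p ^ d ≤ j / p := by
    refine div_le_div_of_nonneg_left (by positivity) hp0 ?_
    rw [hpd]
    exact le_mul_of_one_le_right hp0.le hone
  have h3 : ((#(monicIrreducibles p d) - j : ℕ) : ℝ) / p ^ d ≤ 1 / d :=
    (div_le_div_of_nonneg_right (by exact_mod_cast Nat.sub_le _ _) hpp.le).trans
      (card_monicIrreducibles_div_le p hd)
  have h4 := div_le_div_of_nonneg_right hsub hpp.le
  rw [sub_div] at h4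
  rw [abs_le, add_div]
  have : (0 : ℝ) ≤ 1 / p + j / p := by positivity
  constructor <;> linarith

lemma abs_choose_card_div_sub_le {d : ℕ} (hd : d ≠ 0) (k : ℕ) :
    |((#(monicIrreducibles p d)).choose k : ℝ) / (p : ℝ) ^ (d * k) -
      1 / ((d ^ k * k.factorial : ℕ) : ℝ)| ≤ (k * (1 + k)) / p := by
  have hd1 : (1 : ℝ) ≤ d := by exact_mod_cast Nat.pos_of_ne_zero hd
  have hk : (1 : ℝ) ≤ k.factorial := by exact_mod_cast k.factorial_pos
  have hone : (1 : ℝ) / d ≤ 1 := by rw [div_le_one (by positivity)]; exact hd1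
  have hp0 : (0 : ℝ) < p := by exact_mod_cast hp.out.pos
  have e : (1 : ℝ) / ((d ^ k * k.factorial : ℕ) : ℝ) =
      (1 / (k.factorial : ℝ)) * ∏ _j ∈ range k, (1 : ℝ) / d := by
    rw [prod_const, card_range, one_div_pow]
    push_cast
    field_simp
  rw [choose_div_eq_prod, e, ← mul_sub, abs_mul, abs_of_nonneg (by positivity)]
  refine (mul_le_of_le_one_left (abs_nonneg _) ((div_le_one (by positivity)).2 hk)).trans ?_
  rw [← Real.norm_eq_abs]
  refine (norm_prod_sub_prod_le_sum _ _ _ (fun j _ => ?_) fun j _ => ?_).trans ?_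
  · rw [Real.norm_of_nonneg (by positivity)]
    refine le_trans (div_le_div_of_nonneg_right ?_ (by positivity))
      ((card_monicIrreducibles_div_le p hd).trans hone)
    exact_mod_cast Nat.sub_le _ _
  · rwa [Real.norm_of_nonneg (by positivity)]
  · calc _ ≤ ∑ _j ∈ range k, (1 + k : ℝ) / p := by
          refine sum_le_sum fun j hj => ?_
          rw [Real.norm_eq_abs]
          refine (abs_card_monicIrreducibles_sub_div_sub_le p hd j).trans ?_
          have : (j : ℝ) ≤ k := by exact_mod_cast (mem_range.1 hj).le
          gcongr
      _ = _ := by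
          rw [sum_const, card_range, nsmul_eq_mul, mul_div_assoc]

lemma choose_card_div_le_one {d : ℕ} (hd : d ≠ 0) (k : ℕ) :
    ((#(monicIrreducibles p d)).choose k : ℝ) / (p : ℝ) ^ (d * k) ≤ 1 := by
  have hp0 : (0 : ℝ) < p := by exact_mod_cast hp.out.pos
  rw [div_le_one (by positivity), pow_mul]
  exact_mod_cast (Nat.choose_le_pow _ _).trans (Nat.pow_le_pow_left
    ((Nat.le_mul_of_pos_left _ (Nat.pos_of_ne_zero hd)).trans
      (mul_card_monicIrreducibles_le p hd)) k)

lemma abs_card_splitVectors_div_sub_le {n : ℕ} {r : Fin n → ℕ}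
    (hr : ∑ i : Fin n, ((i : ℕ) + 1) * r i = n) :
    |(#(splitVectors p r) : ℝ) / (p : ℝ) ^ n - splitDelta n r| ≤
      (∑ i, (r i * (1 + r i) : ℝ)) / p := by
  have e : (#(splitVectors p r) : ℝ) / (p : ℝ) ^ n = ∏ i : Fin n,
      ((#(monicIrreducibles p (i + 1))).choose (r i) : ℝ) / (p : ℝ) ^ (((i : ℕ) + 1) * r i) := by
    rw [card_splitVectors hr, prod_div_distrib, prod_pow_eq_pow_sum, hr]
    push_cast
    rfl
  rw [e, splitDelta, ← Real.norm_eq_abs, sum_div]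
  refine (norm_prod_sub_prod_le_sum _ _ _ (fun i _ => ?_) fun i _ => ?_).trans
    (sum_le_sum fun i _ => ?_)
  · rw [Real.norm_of_nonneg (by positivity)]
    exact choose_card_div_le_one p i.1.succ_ne_zero (r i)
  · rw [Real.norm_of_nonneg (by positivity)]
    refine div_le_one_of_le₀ ?_ (by positivity)
    exact_mod_cast Nat.mul_pos (pow_pos i.1.succ_pos _) (Nat.factorial_pos _)
  · exact abs_choose_card_div_sub_le p i.1.succ_ne_zero (r i)

end LocalDensity

lemma splitDelta_pos (n : ℕ) (r : Fin n → ℕ) : 0 < splitDelta n r :=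
  prod_pos fun i _ => by positivity

lemma splitDelta_lt_one {n : ℕ} (hn : 2 ≤ n) {r : Fin n → ℕ}
    (hr : ∑ i : Fin n, ((i : ℕ) + 1) * r i = n) : splitDelta n r < 1 := by
  have hle : ∀ i : Fin n, (1 : ℝ) / ((((i : ℕ) + 1) ^ (r i) * Nat.factorial (r i) : ℕ) : ℝ) ≤ 1 :=
    fun i => div_le_one_of_le₀
      (by exact_mod_cast Nat.mul_pos (pow_pos i.1.succ_pos _) (Nat.factorial_pos _)) (by positivity)
  have hlt : ∃ i : Fin n, 1 < ((i : ℕ) + 1) ^ (r i) * Nat.factorial (r i) := by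
    by_contra! hcon
    have hr1 : ∀ i : Fin n, (i : ℕ) ≠ 0 → r i = 0 := by
      intro i hi
      by_contra h0
      have h1 := hcon i
      have h2 : 2 ≤ ((i : ℕ) + 1) ^ r i :=
        (by omega : 2 ≤ (i : ℕ) + 1).trans (Nat.le_self_pow h0 _)
      have := Nat.le_mul_of_pos_right (((i : ℕ) + 1) ^ r i) (Nat.factorial_pos (r i))
      omega
    have h0 : r ⟨0, by omega⟩ = n := by
      rw [sum_eq_single ⟨0, by omega⟩] at hr
      · simpa using hr
      · intro i _ hi
        rw [hr1 i fun h => hi (Fin.ext h), mul_zero]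
      · simp
    have h1 := hcon ⟨0, by omega⟩
    rw [h0] at h1
    have h2 := Nat.self_le_factorial n
    simp at h1
    omega
  obtain ⟨i, hi⟩ := hlt
  refine (prod_lt_prod (fun i _ => by positivity) (fun i _ => hle i) ⟨i, mem_univ _, ?_⟩).trans_eq
    prod_const_one
  exact (div_lt_one (by positivity)).2 (by exact_mod_cast hi)

section Equidistribution

lemma abs_card_Icc_filter_modEq_sub_le (N : ℕ) {q : ℕ} (hq : 0 < q) (c : ℤ) :
    |(#{m ∈ Icc (-(N : ℤ)) N | m ≡ c [ZMOD q]} : ℝ) - (2 * N + 1) / q| ≤ 1 := by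
  have hI : Icc (-(N : ℤ)) N = Ioc (-(N : ℤ) - 1) N := by
    ext m
    simp only [mem_Icc, mem_Ioc]
    omega
  have h := Int.Ioc_filter_modEq_card (-(N : ℤ) - 1) N (r := (q : ℤ)) (by exact_mod_cast hq) c
  have hq0 : (0 : ℚ) < q := by exact_mod_cast hq
  set A : ℚ := (((N : ℤ) : ℚ) - c) / ((q : ℤ) : ℚ) with hA
  set B : ℚ := (((-(N : ℤ) - 1 : ℤ) : ℚ) - c) / ((q : ℤ) : ℚ) with hB
  have hAB : A - B = (2 * N + 1) / q := by
    rw [hA, hB]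
    push_cast
    field_simp
    ring
  have hle : B ≤ A := by
    rw [← sub_nonneg, hAB]
    positivity
  rw [max_eq_left (sub_nonneg.2 (Int.floor_le_floor hle))] at h
  have hQ : |(#{m ∈ Icc (-(N : ℤ)) N | m ≡ c [ZMOD q]} : ℚ) - (2 * N + 1) / q| ≤ 1 := by
    have h' : (#{m ∈ Icc (-(N : ℤ)) N | m ≡ c [ZMOD q]} : ℚ) = (⌊A⌋ : ℚ) - ⌊B⌋ := by
      rw [hI]
      have h2 := congrArg (Int.cast : ℤ → ℚ) h
      push_cast at h2
      rw [← h2]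
    rw [h', ← hAB, abs_le]
    constructor <;> linarith [Int.floor_le A, Int.floor_le B, Int.lt_floor_add_one A,
      Int.lt_floor_add_one B]
  have hR := (Rat.cast_le (K := ℝ)).2 hQ
  push_cast at hR
  exact hR

variable {U : Finset ℕ}

lemma isCoprime_of_primes (hU : ∀ p ∈ U, p.Prime) :
    (U : Set ℕ).Pairwise (Function.onFun Nat.Coprime fun p => p) := fun p hp q hq hne =>
  (Nat.coprime_primes (hU p hp) (hU q hq)).2 hne

lemma exists_forall_intCast_eq_iff (hU : ∀ p ∈ U, p.Prime) (t : ∀ p ∈ U, ZMod p) :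
    ∃ c : ℤ, ∀ m : ℤ, (∀ p (hp : p ∈ U), (m : ZMod p) = t p hp) ↔
      m ≡ c [ZMOD ((∏ p ∈ U, p : ℕ) : ℤ)] := by
  obtain ⟨c, hc⟩ := Nat.chineseRemainderOfFinset (fun p => if h : p ∈ U then (t p h).val else 0)
    (fun p => p) U (fun p hp => (hU p hp).ne_zero) (isCoprime_of_primes hU)
  have hc' : ∀ p (hp : p ∈ U), ((c : ℤ) : ZMod p) = t p hp := by
    intro p hp
    have : NeZero p := ⟨(hU p hp).ne_zero⟩
    have h := (ZMod.natCast_eq_natCast_iff _ _ _).2 (hc p hp)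
    rw [dif_pos hp, ZMod.natCast_zmod_val] at h
    exact_mod_cast h
  refine ⟨c, fun m => ?_⟩
  rw [Int.modEq_iff_dvd]
  push_cast
  constructor
  · intro h
    refine Finset.prod_dvd_of_coprime (fun p hp q hq hne =>
      Nat.isCoprime_iff_coprime.2 (isCoprime_of_primes hU hp hq hne)) fun p hp => ?_
    rw [← ZMod.intCast_eq_intCast_iff_dvd_sub, h p hp, hc' p hp]
  · intro h p hp
    rw [← hc' p hp, ZMod.intCast_eq_intCast_iff_dvd_sub]
    exact (dvd_prod_of_mem (fun p : ℕ => (p : ℤ)) hp).trans h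

lemma card_coeffBox (n N : ℕ) : #(coeffBox n N) = (2 * N + 1) ^ n := by
  simp only [coeffBox, Fintype.card_piFinset, Int.card_Icc, prod_const, card_univ, Fintype.card_fin]
  congr 1
  omega

lemma abs_card_coeffBox_filter_residues_sub_le (n N : ℕ) (hU : ∀ p ∈ U, p.Prime)
    (t : ∀ p ∈ U, Fin n → ZMod p) :
    |(#{a ∈ coeffBox n N | ∀ p (hp : p ∈ U), (fun i => (a i : ZMod p)) = t p hp} : ℝ) /
        (2 * N + 1) ^ n - 1 / ((∏ p ∈ U, p : ℕ) : ℝ) ^ n| ≤ n / (2 * N + 1) := by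
  set q := ∏ p ∈ U, p with hq
  have hq0 : 0 < q := prod_pos fun p hp => (hU p hp).pos
  have hq1 : (1 : ℝ) ≤ q := by exact_mod_cast hq0
  choose c hc using fun i : Fin n => exists_forall_intCast_eq_iff hU fun p hp => t p hp i
  have hset : {a ∈ coeffBox n N | ∀ p (hp : p ∈ U), (fun i => (a i : ZMod p)) = t p hp} =
      Fintype.piFinset fun i => {m ∈ Icc (-(N : ℤ)) N | m ≡ c i [ZMOD q]} := by
    ext a
    simp only [coeffBox, mem_filter, Fintype.mem_piFinset, forall_and]
    refine and_congr_right fun _ => ⟨fun h i => ?_, fun h p hp => funext fun i => ?_⟩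
    · exact (hc i (a i)).1 fun p hp => congrFun (h p hp) i
    · exact (hc i (a i)).2 (h i) p hp
  have hN : (0 : ℝ) < 2 * N + 1 := by positivity
  have e1 : (#{a ∈ coeffBox n N | ∀ p (hp : p ∈ U), (fun i => (a i : ZMod p)) = t p hp} : ℝ) /
      (2 * N + 1) ^ n = ∏ i : Fin n,
        (#{m ∈ Icc (-(N : ℤ)) N | m ≡ c i [ZMOD q]} : ℝ) / (2 * N + 1) := by
    rw [hset, Fintype.card_piFinset, prod_div_distrib, prod_const, card_univ, Fintype.card_fin]
    push_cast
    rfl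
  have e2 : 1 / (q : ℝ) ^ n = ∏ _i : Fin n, 1 / (q : ℝ) := by
    rw [prod_const, card_univ, Fintype.card_fin, one_div_pow]
  rw [e1, e2, ← Real.norm_eq_abs]
  refine (norm_prod_sub_prod_le_sum _ _ _ (fun i _ => ?_) fun i _ => ?_).trans ?_
  · rw [Real.norm_of_nonneg (by positivity), div_le_one hN]
    have h : #{m ∈ Icc (-(N : ℤ)) N | m ≡ c i [ZMOD q]} ≤ 2 * N + 1 := by
      refine (card_filter_le _ _).trans_eq ?_
      rw [Int.card_Icc]
      omega
    exact_mod_cast h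
  · rw [Real.norm_of_nonneg (by positivity), div_le_one (by positivity)]
    exact hq1
  · calc _ ≤ ∑ _i : Fin n, (1 : ℝ) / (2 * N + 1) := by
          refine sum_le_sum fun i _ => ?_
          have h := abs_card_Icc_filter_modEq_sub_le N hq0 (c i)
          have e : (#{m ∈ Icc (-(N : ℤ)) N | m ≡ c i [ZMOD q]} : ℝ) / (2 * N + 1) - 1 / q =
              ((#{m ∈ Icc (-(N : ℤ)) N | m ≡ c i [ZMOD q]} : ℝ) - (2 * N + 1) / q) /
                (2 * N + 1) := by
            field_simp
          rw [e, Real.norm_eq_abs, abs_div, abs_of_pos hN]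
          exact div_le_div_of_nonneg_right h hN.le
      _ = n / (2 * N + 1) := by
          rw [sum_const, card_univ, Fintype.card_fin, nsmul_eq_mul, mul_one_div]

lemma abs_card_coeffBox_filter_sub_prod_le (n N : ℕ) (hU : ∀ p ∈ U, p.Prime)
    (T : ∀ p, Finset (Fin n → ZMod p)) :
    |(#{a ∈ coeffBox n N | ∀ p ∈ U, (fun i => (a i : ZMod p)) ∈ T p} : ℝ) /
        #(coeffBox n N) - ∏ p ∈ U, (#(T p) : ℝ) / p ^ n| ≤
      ((∏ p ∈ U, p : ℕ) : ℝ) ^ n * (n / (2 * N + 1)) := by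
  set q := ∏ p ∈ U, p with hq
  have hcard : #{a ∈ coeffBox n N | ∀ p ∈ U, (fun i => (a i : ZMod p)) ∈ T p} =
      ∑ t ∈ U.pi T,
        #{a ∈ coeffBox n N | ∀ p (hp : p ∈ U), (fun i => (a i : ZMod p)) = t p hp} := by
    rw [card_eq_sum_card_fiberwise (f := fun a p (_ : p ∈ U) i => (a i : ZMod p)) (t := U.pi T)]
    · refine sum_congr rfl fun t ht => congrArg card ?_
      rw [Finset.mem_pi] at ht
      ext a
      simp only [mem_filter, funext_iff (f := fun p (_ : p ∈ U) i => (a i : ZMod p))]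
      constructor
      · rintro ⟨⟨h1, -⟩, h2⟩
        exact ⟨h1, fun p hp => congrFun (h2 p) hp⟩
      · rintro ⟨h1, h2⟩
        exact ⟨⟨h1, fun p hp => by rw [h2 p hp]; exact ht p hp⟩, fun p => funext fun hp => h2 p hp⟩
    · intro a ha
      rw [mem_coe, mem_filter] at ha
      rw [mem_coe, Finset.mem_pi]
      exact ha.2
  have hprod : ∏ p ∈ U, (#(T p) : ℝ) / p ^ n = ∑ _t ∈ U.pi T, 1 / (q : ℝ) ^ n := by
    rw [sum_const, card_pi, prod_div_distrib, prod_pow, nsmul_eq_mul, mul_one_div, hq]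
    push_cast
    rfl
  have hle : #(U.pi T) ≤ q ^ n := by
    rw [card_pi, hq, ← prod_pow]
    refine prod_le_prod' fun p hp => ?_
    have : NeZero p := ⟨(hU p hp).ne_zero⟩
    refine (card_le_univ _).trans_eq ?_
    rw [Fintype.card_fun, ZMod.card, Fintype.card_fin]
  rw [hcard, hprod, card_coeffBox]
  push_cast
  rw [sum_div, ← sum_sub_distrib]
  refine (abs_sum_le_sum_abs _ _).trans ?_
  refine (sum_le_sum fun t _ => abs_card_coeffBox_filter_residues_sub_le n N hU t).trans ?_
  rw [sum_const, nsmul_eq_mul]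
  refine mul_le_mul_of_nonneg_right ?_ (by positivity)
  exact_mod_cast hle

end Equidistribution

/-- The proportion of monic polynomials of degree `n` over `𝔽_p` with splitting type `r`. -/
def localDensity {n : ℕ} (r : Fin n → ℕ) (p : ℕ) : ℝ :=
  if h : p.Prime then (#(@splitVectors p ⟨h⟩ n r) : ℝ) / p ^ n else 0

lemma localDensity_eq {n : ℕ} (r : Fin n → ℕ) (p : ℕ) [hp : Fact p.Prime] :
    localDensity r p = (#(splitVectors p r) : ℝ) / p ^ n := dif_pos hp.out

lemma localDensity_nonneg {n : ℕ} (r : Fin n → ℕ) (p : ℕ) : 0 ≤ localDensity r p := by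
  unfold localDensity
  split_ifs <;> positivity

lemma localDensity_le_one {n : ℕ} (r : Fin n → ℕ) (p : ℕ) : localDensity r p ≤ 1 := by
  unfold localDensity
  split_ifs with h
  · have : Fact p.Prime := ⟨h⟩
    refine div_le_one_of_le₀ ?_ (by positivity)
    have hle := card_le_univ (splitVectors p r)
    rw [Fintype.card_fun, ZMod.card, Fintype.card_fin] at hle
    exact_mod_cast hle
  · exact zero_le_one

lemma hasSplitType_iff {n : ℕ} (r : Fin n → ℕ) (a : Fin n → ℤ) (p : ℕ) [Fact p.Prime] :
    HasSplitType n r a p ↔ (fun i => (a i : ZMod p)) ∈ splitVectors p r := by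
  rw [HasSplitType, intPoly_eq_monicPoly, map_monicPoly, splitVectors, mem_filter]
  simp

lemma abs_card_filter_hasSplitType_sub_le {n : ℕ} (r : Fin n → ℕ) (N : ℕ) {U : Finset ℕ}
    (hU : ∀ p ∈ U, p.Prime) :
    |(#{a ∈ coeffBox n N | ∀ p ∈ U, HasSplitType n r a p} : ℝ) / #(coeffBox n N) -
      ∏ p ∈ U, localDensity r p| ≤ ((∏ p ∈ U, p : ℕ) : ℝ) ^ n * (n / (2 * N + 1)) := by
  have h := abs_card_coeffBox_filter_sub_prod_le n N hU
    fun p => if hp : p.Prime then @splitVectors p ⟨hp⟩ n r else ∅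
  have e1 : {a ∈ coeffBox n N | ∀ p ∈ U, HasSplitType n r a p} = {a ∈ coeffBox n N | ∀ p ∈ U,
      (fun i => (a i : ZMod p)) ∈ if hp : p.Prime then @splitVectors p ⟨hp⟩ n r else ∅} := by
    refine filter_congr fun a _ => forall₂_congr fun p hp => ?_
    have : Fact p.Prime := ⟨hU p hp⟩
    rw [dif_pos (hU p hp), hasSplitType_iff]
  have e2 : ∏ p ∈ U, localDensity r p = ∏ p ∈ U,
      (#(if hp : p.Prime then @splitVectors p ⟨hp⟩ n r else ∅) : ℝ) / p ^ n := by
    refine prod_congr rfl fun p hp => ?_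
    have : Fact p.Prime := ⟨hU p hp⟩
    rw [dif_pos (hU p hp), localDensity_eq]
  rw [e1, e2]
  exact h

/-- The primes `p ≤ x`. -/
def primesUpTo (x : ℝ) : Finset ℕ := (range (⌊x⌋₊ + 1)).filter Nat.Prime

lemma card_primesUpTo (x : ℝ) : #(primesUpTo x) = primePi x := rfl

lemma prime_of_mem_primesUpTo {x : ℝ} {p : ℕ} (hp : p ∈ primesUpTo x) : p.Prime :=
  (mem_filter.1 hp).2

lemma card_filter_primesUpTo {n : ℕ} (r : Fin n → ℕ) (a : Fin n → ℤ) (x : ℝ) :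
    #{p ∈ primesUpTo x | HasSplitType n r a p} = countSplit n r a x := by
  rw [primesUpTo, filter_filter]
  rfl

lemma tendsto_primePi : Tendsto primePi atTop atTop := by
  have h : primePi = fun x : ℝ => Nat.primeCounting ⌊x⌋₊ := by
    funext x
    rw [Nat.primeCounting, Nat.primeCounting', Nat.count_eq_card_filter_range]
    unfold primePi
    congr!
  rw [h]
  exact Nat.tendsto_primeCounting.comp tendsto_nat_floor_atTop

lemma sum_inv_le_harmonic (S : Finset ℕ) (hS : ∀ s ∈ S, 0 < s) :
    ∑ s ∈ S, (1 : ℝ) / s ≤ (harmonic #S : ℝ) := by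
  induction S using Finset.induction_on_max with
  | empty => simp
  | insert m S hm ih =>
    have hnot : m ∉ S := fun h => (hm m h).false
    have hcard : #S + 1 ≤ m := by
      have hsub : S ⊆ Ico 1 m := fun s hs =>
        mem_Ico.2 ⟨hS s (mem_insert_of_mem hs), hm s hs⟩
      have h1 := card_le_card hsub
      rw [Nat.card_Ico] at h1
      have := hS m (mem_insert_self _ _)
      omega
    rw [sum_insert hnot, card_insert_of_notMem hnot, harmonic_succ, add_comm]
    push_cast
    refine add_le_add (ih fun s hs => hS s (mem_insert_of_mem hs)) ?_
    rw [one_div]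
    refine inv_anti₀ (by positivity) ?_
    exact_mod_cast hcard

lemma tendsto_one_add_log_div_sqrt :
    Tendsto (fun m : ℕ => (1 + Real.log m) / √(m : ℝ)) atTop (nhds 0) := by
  have h1 : Tendsto (fun y : ℝ => Real.log y / y ^ (1 / 2 : ℝ)) atTop (nhds 0) :=
    (isLittleO_log_rpow_atTop (by norm_num : (0 : ℝ) < 1 / 2)).tendsto_div_nhds_zero
  have h2 : Tendsto (fun y : ℝ => 1 / √y) atTop (nhds 0) := by
    simpa only [one_div, Function.comp_def] using
      tendsto_inv_atTop_zero.comp Real.tendsto_sqrt_atTop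
  have h3 := (h2.add h1).comp (tendsto_natCast_atTop_atTop (R := ℝ))
  rw [zero_add] at h3
  refine h3.congr fun m => ?_
  simp only [Function.comp_apply, ← Real.sqrt_eq_rpow, ← add_div]

lemma tendsto_sum_localDensity_sub_div_sqrt {n : ℕ} {r : Fin n → ℕ}
    (hr : ∑ i : Fin n, ((i : ℕ) + 1) * r i = n) {x : ℕ → ℝ} (hx : Tendsto x atTop atTop) :
    Tendsto (fun N => (∑ p ∈ primesUpTo (x N), |localDensity r p - splitDelta n r|) /
      √(#(primesUpTo (x N)) : ℝ)) atTop (nhds 0) := by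
  set c : ℝ := ∑ i, (r i * (1 + r i) : ℝ)
  have hc : 0 ≤ c := sum_nonneg fun i _ => by positivity
  have hlim := (tendsto_one_add_log_div_sqrt.comp (tendsto_primePi.comp hx)).const_mul c
  rw [mul_zero] at hlim
  refine squeeze_zero (fun N => by positivity) (fun N => ?_) hlim
  simp only [Function.comp_apply, ← card_primesUpTo]
  rw [← mul_div_assoc]
  refine div_le_div_of_nonneg_right ?_ (Real.sqrt_nonneg _)
  calc _ ≤ ∑ p ∈ primesUpTo (x N), c * (1 / p) := by
        refine sum_le_sum fun p hp => ?_
        have : Fact p.Prime := ⟨prime_of_mem_primesUpTo hp⟩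
        rw [localDensity_eq, mul_one_div]
        exact abs_card_splitVectors_div_sub_le p hr
    _ ≤ _ := by
        rw [← mul_sum]
        refine mul_le_mul_of_nonneg_left ((sum_inv_le_harmonic _ fun p hp =>
          (prime_of_mem_primesUpTo hp).pos).trans (harmonic_le_one_add_log _)) hc

lemma tendsto_pow_div_of_le_rpow_inv_log_log {x : ℕ → ℝ} (hx_top : Tendsto x atTop atTop)
    (hx_le : ∀ N : ℕ, 3 ≤ N → x N ≤ (N : ℝ) ^ (1 / Real.log (Real.log N))) (K : ℕ) :
    Tendsto (fun N : ℕ => x N ^ K / (2 * N + 1)) atTop (nhds 0) := by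
  have hlog : Tendsto (fun N : ℕ => Real.log (Real.log N)) atTop atTop :=
    Real.tendsto_log_atTop.comp (Real.tendsto_log_atTop.comp tendsto_natCast_atTop_atTop)
  have hlim : Tendsto (fun N : ℕ => (N : ℝ) ^ (-(1 / 2) : ℝ)) atTop (nhds 0) :=
    (tendsto_rpow_neg_atTop (by norm_num)).comp tendsto_natCast_atTop_atTop
  refine squeeze_zero' ?_ ?_ hlim
  · filter_upwards [hx_top.eventually (eventually_ge_atTop 0)] with N hN
    positivity
  · filter_upwards [hx_top.eventually (eventually_ge_atTop 0), eventually_ge_atTop 3,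
      hlog.eventually (eventually_ge_atTop (2 * K + 1 : ℝ))] with N hN h3 hl
    have hN1 : (1 : ℝ) ≤ N := by exact_mod_cast (by omega : 1 ≤ N)
    have hN0 : (0 : ℝ) < N := by positivity
    have hl0 : (0 : ℝ) < Real.log (Real.log N) := lt_of_lt_of_le (by positivity) hl
    have h1 : x N ^ K ≤ (N : ℝ) ^ (1 / 2 : ℝ) := by
      refine (pow_le_pow_left₀ hN (hx_le N h3) K).trans ?_
      rw [← Real.rpow_natCast, ← Real.rpow_mul hN0.le]
      refine Real.rpow_le_rpow_of_exponent_le hN1 ?_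
      rw [one_div_mul_eq_div, div_le_div_iff₀ hl0 two_pos]
      linarith
    calc x N ^ K / (2 * N + 1) ≤ (N : ℝ) ^ (1 / 2 : ℝ) / N := by
          refine div_le_div₀ (by positivity) h1 hN0 (by linarith)
      _ = (N : ℝ) ^ (-(1 / 2) : ℝ) := by
          rw [← Real.rpow_sub_one hN0.ne']
          norm_num

lemma coeffBox_nonempty (n N : ℕ) : (coeffBox n N).Nonempty := by
  rw [← card_pos, card_coeffBox]
  positivity

lemma exists_joint_error {n : ℕ} (r : Fin n → ℕ) {x : ℕ → ℝ} (hx_top : Tendsto x atTop atTop)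
    (hx_le : ∀ N : ℕ, 3 ≤ N → x N ≤ (N : ℝ) ^ (1 / Real.log (Real.log N))) (k : ℕ) :
    ∃ ε : ℕ → ℝ, (∀ᶠ N in atTop, ∀ U ⊆ primesUpTo (x N), #U ≤ k →
      |(#{a ∈ coeffBox n N | ∀ p ∈ U, HasSplitType n r a p} : ℝ) / #(coeffBox n N) -
        ∏ p ∈ U, localDensity r p| ≤ ε N) ∧
      Tendsto (fun N => (#(primesUpTo (x N)) : ℝ) ^ k * ε N) atTop (nhds 0) := by
  refine ⟨fun N => (x N ^ k) ^ n * (n / (2 * N + 1)), ?_, ?_⟩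
  · filter_upwards [hx_top.eventually (eventually_ge_atTop 1)] with N hN U hU hUk
    refine (abs_card_filter_hasSplitType_sub_le r N fun p hp =>
      prime_of_mem_primesUpTo (hU hp)).trans ?_
    refine mul_le_mul_of_nonneg_right (pow_le_pow_left₀ (by positivity) ?_ n) (by positivity)
    push_cast
    refine le_trans ?_ (pow_le_pow_right₀ hN hUk)
    rw [← prod_const]
    refine prod_le_prod (fun p _ => by positivity) fun p hp => ?_
    have h1 := mem_range.1 (mem_filter.1 (hU hp)).1
    exact (Nat.le_floor_iff (by positivity)).1 (Nat.lt_succ_iff.1 h1)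
  · have hlim := (tendsto_pow_div_of_le_rpow_inv_log_log hx_top hx_le (k + k * n)).const_mul
      ((2 : ℝ) ^ k * n)
    rw [mul_zero] at hlim
    refine squeeze_zero' ?_ ?_ hlim
    · filter_upwards [hx_top.eventually (eventually_ge_atTop 1)] with N hN
      positivity
    · filter_upwards [hx_top.eventually (eventually_ge_atTop 1)] with N hN
      have hcard : (#(primesUpTo (x N)) : ℝ) ≤ 2 * x N := by
        have h1 : #(primesUpTo (x N)) ≤ ⌊x N⌋₊ + 1 :=
          (card_filter_le _ _).trans_eq (card_range _)
        have h2 : (#(primesUpTo (x N)) : ℝ) ≤ ⌊x N⌋₊ + 1 := by exact_mod_cast h1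
        linarith [Nat.floor_le (by positivity : 0 ≤ x N)]
      calc _ ≤ (2 * x N) ^ k * ((x N ^ k) ^ n * (n / (2 * N + 1))) := by gcongr
        _ = _ := by
          rw [mul_pow, ← pow_mul, pow_add]
          ring

/-- The normalized number of primes `p ≤ x` modulo which the polynomial with coefficients `f` has
splitting type `r`. -/
def normalizedCount (n : ℕ) (r : Fin n → ℕ) (f : Fin n → ℤ) (x : ℝ) : ℝ :=
  ((countSplit n r f x : ℝ) - splitDelta n r * (primePi x : ℝ)) /
    ((splitDelta n r - splitDelta n r ^ 2) ^ ((1 : ℝ) / 2) * (primePi x : ℝ) ^ ((1 : ℝ) / 2))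

/-- The central limit theorem for the normalized counts on the full box of polynomials. -/
theorem tendsto_coeffBox_normalizedCount {n : ℕ} (hn : 2 ≤ n) {r : Fin n → ℕ}
    (hr : ∑ i : Fin n, ((i : ℕ) + 1) * r i = n) {x : ℕ → ℝ} (hx_top : Tendsto x atTop atTop)
    (hx_le : ∀ N : ℕ, 3 ≤ N → x N ≤ (N : ℝ) ^ (1 / Real.log (Real.log N)))
    {a b : ℝ} (hab : a < b) :
    Tendsto (fun N => (#{f ∈ coeffBox n N |
        a ≤ normalizedCount n r f (x N) ∧ normalizedCount n r f (x N) ≤ b} : ℝ) /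
          #(coeffBox n N)) atTop
      (nhds ((1 / Real.sqrt (2 * Real.pi)) * ∫ t in a..b, Real.exp (-t ^ 2 / 2))) := by
  have h := tendsto_card_filter_div_gaussian (coeffBox n) (coeffBox_nonempty n)
    (fun N => primesUpTo (x N)) (HasSplitType n r) (localDensity r) (localDensity_nonneg r)
    (localDensity_le_one r) (splitDelta_pos n r) (splitDelta_lt_one hn hr)
    (tendsto_primePi.comp hx_top) (tendsto_sum_localDensity_sub_div_sqrt hr hx_top)
    (exists_joint_error r hx_top hx_le) hab
  simp only [card_filter_primesUpTo, card_primesUpTo] at h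
  simpa only [normalizedCount, ← Real.sqrt_eq_rpow] using h

open NumberField in
lemma exists_frobenius_mod_maximal (K : Type*) [Field K] [NumberField K] [IsGalois ℚ K]
    (p : ℕ) [hp : Fact p.Prime] :
    ∃ (σ : Gal(K/ℚ)) (Q : Ideal (𝓞 K)), Q.IsMaximal ∧ Finite (𝓞 K ⧸ Q) ∧
      (p : 𝓞 K) ∈ Q ∧ ∀ x : 𝓞 K, σ • x - x ^ p ∈ Q := by
  have hmax : (Ideal.span {(p : ℤ)}).IsMaximal :=
    PrincipalIdealRing.isMaximal_of_irreducible (Nat.prime_iff_prime_int.1 hp.out).irreducible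
  obtain ⟨Q, hQ, hover⟩ :=
    Ideal.exists_maximal_ideal_liesOver_of_isIntegral (S := 𝓞 K) (Ideal.span {(p : ℤ)})
  have hpQ : (p : 𝓞 K) ∈ Q := by
    have h : (p : ℤ) ∈ Q.under ℤ := hover.over ▸ Ideal.mem_span_singleton_self _
    simpa using h
  have hne : Q ≠ ⊥ := by
    rintro rfl
    exact hp.out.ne_zero (by simpa using hpQ)
  have hfin : Finite (𝓞 K ⧸ Q) := Q.finiteQuotientOfFreeOfNeBot hne
  obtain ⟨σ, hσ⟩ := IsArithFrobAt.exists_of_isInvariant ℤ Gal(K/ℚ) Q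
  refine ⟨σ, Q, hQ, hfin, hpQ, fun x => ?_⟩
  have hcard : Nat.card (ℤ ⧸ Q.under ℤ) = p := by
    rw [← hover.over, Nat.card_congr (Int.quotientSpanNatEquivZMod p).toEquiv, Nat.card_zmod]
  have := hσ x
  rw [hcard] at this
  exact this

section FrobeniusCycles

variable {p : ℕ} [hp : Fact p.Prime] {κ : Type*} [Field κ] [Fintype κ] [Algebra (ZMod p) κ]
  {Ω : Type*} {s : Equiv.Perm Ω} {ρ : Ω → κ}

lemma minimalPeriod_eq_natDegree_minpoly (hinj : Function.Injective ρ)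
    (hs : ∀ ω, ρ (s ω) = ρ ω ^ p) (ω : Ω) :
    Function.minimalPeriod s ω = (minpoly (ZMod p) (ρ ω)).natDegree := by
  have hiter : ∀ k : ℕ, ρ (s^[k] ω) = ρ ω ^ p ^ k := by
    intro k
    induction k with
    | zero => simp
    | succ k ih => rw [Function.iterate_succ_apply', hs, ih, ← pow_mul, pow_succ]
  have h_int := Algebra.IsIntegral.isIntegral (R := ZMod p) (ρ ω)
  have hdvd : ∀ k : ℕ, Function.minimalPeriod s ω ∣ k ↔
      (minpoly (ZMod p) (ρ ω)).natDegree ∣ k := by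
    intro k
    rw [← Function.isPeriodicPt_iff_minimalPeriod_dvd,
      (minpoly.irreducible h_int).natDegree_dvd_iff_dvd_X_pow_card_pow_sub_X, Nat.card_zmod,
      minpoly.dvd_iff, Function.IsPeriodicPt, Function.IsFixedPt, ← hinj.eq_iff, hiter]
    simp [sub_eq_zero]
  exact Nat.dvd_antisymm ((hdvd _).2 dvd_rfl) ((hdvd _).1 dvd_rfl)

lemma card_filter_minimalPeriod_eq [Fintype Ω] {g : (ZMod p)[X]} (hg : g ≠ 0)
    (hsplit : Splits (g.map (algebraMap (ZMod p) κ))) (hinj : Function.Injective ρ)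
    (hs : ∀ ω, ρ (s ω) = ρ ω ^ p) (hroot : ∀ β, (∃ ω, ρ ω = β) ↔ aeval β g = 0) (d : ℕ) :
    #{ω | Function.minimalPeriod s ω = d} = d * #{h ∈ monicIrreducibles p d | h ∣ g} := by
  rw [mul_comm, ← smul_eq_mul, ← sum_const]
  rw [card_eq_sum_card_fiberwise (f := fun ω => minpoly (ZMod p) (ρ ω))
    (t := {h ∈ monicIrreducibles p d | h ∣ g})]
  · refine sum_congr rfl fun h hh => ?_
    obtain ⟨hh, hdvd⟩ := mem_filter.1 hh
    have hs' : Splits (h.map (algebraMap (ZMod p) κ)) :=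
      Splits.of_dvd hsplit (map_ne_zero hg) (Polynomial.map_dvd _ hdvd)
    rw [← card_image_of_injective _ hinj]
    refine Eq.trans (congrArg card ?_) (card_filter_minpoly_eq_of_splits p κ hh hs')
    ext β
    simp only [mem_image, mem_filter, mem_univ, true_and,
      minimalPeriod_eq_natDegree_minpoly hinj hs]
    constructor
    · rintro ⟨ω, ⟨-, h2⟩, rfl⟩
      exact h2
    · rintro rfl
      obtain ⟨ω, rfl⟩ := (hroot β).2 (aeval_eq_zero_of_dvd_aeval_eq_zero hdvd (minpoly.aeval _ _))
      exact ⟨ω, ⟨(mem_monicIrreducibles.1 hh).2.2, rfl⟩, rfl⟩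
  · intro ω hω
    have h_int := Algebra.IsIntegral.isIntegral (R := ZMod p) (ρ ω)
    have h1 := (mem_filter.1 hω).2
    rw [minimalPeriod_eq_natDegree_minpoly hinj hs] at h1
    exact mem_filter.2 ⟨mem_monicIrreducibles.2 ⟨minpoly.monic h_int, minpoly.irreducible h_int, h1⟩,
      minpoly.dvd _ _ ((hroot _).1 ⟨ω, rfl⟩)⟩

end FrobeniusCycles

open NumberField in
lemma exists_galActionHom_card_filter_minimalPeriod {f : ℤ[X]} (hf : f.Monic)
    (E : Type*) [Field E] [NumberField E] [IsGalois ℚ E]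
    [hsplit : Fact (((f.map (Int.castRingHom ℚ)).map (algebraMap ℚ E)).Splits)]
    {p : ℕ} [hp : Fact p.Prime] (hsq : Squarefree (f.map (Int.castRingHom (ZMod p)))) :
    Fintype.card ((f.map (Int.castRingHom ℚ)).rootSet E) = f.natDegree ∧
    ∃ s ∈ (Gal.galActionHom (f.map (Int.castRingHom ℚ)) E).range, ∀ d,
      #{ω | Function.minimalPeriod s ω = d} =
        d * #{h ∈ monicIrreducibles p d | h ∣ f.map (Int.castRingHom (ZMod p))} := by
  obtain ⟨σ, Q, hQ, hfin, hpQ, hσ⟩ := exists_frobenius_mod_maximal E p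
  let : Field (𝓞 E ⧸ Q) := Ideal.Quotient.field Q
  let : Fintype (𝓞 E ⧸ Q) := Fintype.ofFinite _
  set π := Ideal.Quotient.mk Q
  have hcast : ((p : ℕ) : 𝓞 E ⧸ Q) = 0 := by
    rw [← map_natCast π]
    exact Ideal.Quotient.eq_zero_iff_mem.2 hpQ
  have hchar : CharP (𝓞 E ⧸ Q) p := (CharP.charP_iff_prime_eq_zero hp.out).2 hcast
  let : Algebra (ZMod p) (𝓞 E ⧸ Q) := ZMod.algebra _ p
  set q := f.map (Int.castRingHom ℚ) with hq
  set g := f.map (Int.castRingHom (ZMod p)) with hg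
  have hqE : q.map (algebraMap ℚ E) = f.map (Int.castRingHom E) := by
    rw [hq, Polynomial.map_map]
    congr 1
    exact RingHom.ext_int _ _
  have hgκ : g.map (algebraMap (ZMod p) (𝓞 E ⧸ Q)) = f.map (Int.castRingHom (𝓞 E ⧸ Q)) := by
    rw [hg, Polynomial.map_map]
    congr 1
    exact RingHom.ext_int _ _
  have hsp := hsplit.out
  rw [hqE] at hsp
  have hq0 : q ≠ 0 := (hf.map _).ne_zero
  have hmem : ∀ x, x ∈ (f.map (Int.castRingHom E)).roots ↔ x ∈ q.rootSet E := by
    intro x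
    rw [mem_rootSet, and_iff_right hq0, ← hqE, mem_roots (map_ne_zero hq0), IsRoot.def,
      eval_map_algebraMap]
  have h_int : ∀ x ∈ (f.map (Int.castRingHom E)).roots, ∃ y : 𝓞 E, algebraMap (𝓞 E) E y = x := by
    intro x hx
    refine (IsIntegralClosure.isIntegral_iff (R := ℤ)).1 ⟨f, hf, ?_⟩
    have := isRoot_of_mem_roots hx
    rwa [IsRoot.def, eval_map] at this
  choose! lift hlift using h_int
  set m : Multiset (𝓞 E) := (f.map (Int.castRingHom E)).roots.map lift
  have hm : m.map (algebraMap (𝓞 E) E) = (f.map (Int.castRingHom E)).roots := by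
    simp only [m, Multiset.map_map]
    exact (Multiset.map_congr rfl hlift).trans (Multiset.map_id _)
  have hfA : f.map (Int.castRingHom (𝓞 E)) = (m.map (X - C ·)).prod := by
    apply Polynomial.map_injective (algebraMap (𝓞 E) E) (FaithfulSMul.algebraMap_injective _ _)
    rw [Polynomial.map_map, Polynomial.map_multiset_prod, Multiset.map_map]
    rw [show (algebraMap (𝓞 E) E).comp (Int.castRingHom (𝓞 E)) = Int.castRingHom E from
      RingHom.ext_int _ _]
    conv_lhs => rw [hsp.eq_prod_roots_of_monic (hf.map _), ← hm, Multiset.map_map]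
    simp
  have hfκ : f.map (Int.castRingHom (𝓞 E ⧸ Q)) = ((m.map π).map (X - C ·)).prod := by
    rw [show Int.castRingHom (𝓞 E ⧸ Q) = π.comp (Int.castRingHom (𝓞 E)) from
      RingHom.ext_int _ _, ← Polynomial.map_map, hfA, Polynomial.map_multiset_prod,
      Multiset.map_map, Multiset.map_map]
    simp [m]
  have hrootsκ : (f.map (Int.castRingHom (𝓞 E ⧸ Q))).roots = m.map π := by
    rw [hfκ, roots_multiset_prod_X_sub_C]
  have hnodup : (m.map π).Nodup := by
    rw [← hrootsκ, ← hgκ]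
    exact nodup_roots ((PerfectField.separable_iff_squarefree.2 hsq).map)
  have hmnodup : (f.map (Int.castRingHom E)).roots.Nodup := by
    rw [← hm]
    exact (Multiset.Nodup.of_map _ hnodup).map (FaithfulSMul.algebraMap_injective _ _)
  constructor
  · rw [← hf.natDegree_map (Int.castRingHom E), hsp.natDegree_eq_card_roots,
      ← Multiset.toFinset_card_of_nodup hmnodup, ← Set.toFinset_card]
    congr 1
    ext x
    rw [Set.mem_toFinset, Multiset.mem_toFinset, hmem]
  let ρ : q.rootSet E → 𝓞 E ⧸ Q := fun ω => π (lift ω)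
  have hlift' : ∀ ω : q.rootSet E, algebraMap (𝓞 E) E (lift ω) = ω := fun ω =>
    hlift _ ((hmem _).2 ω.2)
  have hmemm : ∀ ω : q.rootSet E, lift ω ∈ m := fun ω =>
    Multiset.mem_map_of_mem _ ((hmem _).2 ω.2)
  refine ⟨_, ⟨Gal.restrict q E σ, rfl⟩, fun d => ?_⟩
  refine card_filter_minimalPeriod_eq (ρ := ρ) (hf.map _).ne_zero ?_ ?_ ?_ ?_ d
  · rw [hgκ, hfκ]
    exact Splits.multisetProd (by simp +contextual [Splits.X_sub_C])
  · intro ω₁ ω₂ h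
    have := Multiset.inj_on_of_nodup_map hnodup _ (hmemm ω₁) _ (hmemm ω₂) h
    exact Subtype.ext (by rw [← hlift' ω₁, this, hlift'])
  · intro ω
    have h := hσ (lift ω)
    rw [← Ideal.Quotient.eq, map_pow] at h
    refine Eq.trans ?_ h
    simp only [ρ]
    congr 1
    apply FaithfulSMul.algebraMap_injective (𝓞 E) E
    rw [hlift', Gal.galActionHom_restrict q E σ ω]
    exact (congrArg σ (hlift' ω)).symm
  · intro β
    rw [← eval_map_algebraMap, hgκ, ← IsRoot.def, ← mem_roots (hf.map _).ne_zero, hrootsκ,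
      Multiset.mem_map]
    constructor
    · rintro ⟨ω, rfl⟩
      exact ⟨_, hmemm ω, rfl⟩
    · rintro ⟨y, hy, rfl⟩
      obtain ⟨x, hx, rfl⟩ := Multiset.mem_map.1 hy
      exact ⟨⟨x, (hmem _).1 hx⟩, rfl⟩

section PermGroup

variable {Ω : Type*} [Fintype Ω]

lemma exists_pow_apply_eq_of_card_minimalPeriod {s : Equiv.Perm Ω} {d : ℕ}
    (hcard : #{ω | Function.minimalPeriod s ω = d} = d) {b c : Ω}
    (hb : Function.minimalPeriod s b = d) (hc : Function.minimalPeriod s c = d) :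
    ∃ k : ℕ, (s ^ k) b = c := by
  have himage : (range d).image (fun k => s^[k] b) =
      ({ω | Function.minimalPeriod s ω = d} : Finset Ω) := by
    refine eq_of_subset_of_card_le ?_ ?_
    · intro ω hω
      obtain ⟨k, -, rfl⟩ := mem_image.1 hω
      rw [mem_filter, and_iff_right (mem_univ _), Function.minimalPeriod_apply_iterate _ k, hb]
      exact Function.minimalPeriod_pos_iff_mem_periodicPts.1
        (Function.minimalPeriod_pos_of_mem_periodicPts
          (Function.Injective.mem_periodicPts s.injective b))
    · rw [hcard, card_image_of_injOn, card_range]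
      intro i hi j hj hij
      refine Function.iterate_injOn_Iio_minimalPeriod (f := s) (x := b) ?_ ?_ hij
      · simpa [hb] using hi
      · simpa [hb] using hj
  have : c ∈ (range d).image (fun k => s^[k] b) := by
    rw [himage]
    exact mem_filter.2 ⟨mem_univ _, hc⟩
  obtain ⟨k, -, hk⟩ := mem_image.1 this
  exact ⟨k, by rw [Equiv.Perm.coe_pow]; exact hk⟩

lemma isSwap_of_card_minimalPeriod_one {s : Equiv.Perm Ω}
    (h : #{ω | Function.minimalPeriod s ω = 1} + 2 = Fintype.card Ω) : s.IsSwap := by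
  rw [← Equiv.Perm.card_support_eq_two]
  have h1 := card_filter_add_card_filter_not (s := (univ : Finset Ω))
    (fun ω => Function.minimalPeriod s ω = 1)
  have h2 : s.support = ({ω | ¬ Function.minimalPeriod s ω = 1} : Finset Ω) := by
    ext ω
    simp [Function.minimalPeriod_eq_one_iff_isFixedPt, Function.IsFixedPt]
  rw [h2]
  rw [card_univ] at h1
  omega

/-- A doubly transitive group of permutations containing a transposition is the whole symmetric
group. -/
lemma eq_top_of_exists_swap {H : Subgroup (Equiv.Perm Ω)} (htrans : ∀ b c, ∃ h ∈ H, h b = c)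
    (hswap : ∃ s ∈ H, s.IsSwap)
    (hfix : ∃ ω, ∀ b ≠ ω, ∀ c ≠ ω, ∃ h ∈ H, h ω = ω ∧ h b = c) : H = ⊤ := by
  obtain ⟨s, hs, x, y, hxy, rfl⟩ := hswap
  obtain ⟨ω, hω⟩ := hfix
  obtain ⟨h, hh, rfl⟩ := htrans x ω
  have hconj : ∀ {g : Equiv.Perm Ω} {u v : Ω}, g ∈ H → Equiv.swap u v ∈ H →
      Equiv.swap (g u) (g v) ∈ H := fun hg huv => by
    rw [Equiv.swap_apply_apply]
    exact H.mul_mem (H.mul_mem hg huv) (H.inv_mem hg)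
  have hstar : ∀ c, Equiv.swap (h x) c ∈ H := by
    intro c
    by_cases hc : c = h x
    · rw [hc, Equiv.swap_self]
      exact H.one_mem
    obtain ⟨k, hk, hk1, hk2⟩ := hω (h y) (h.injective.ne hxy.symm) c hc
    have := hconj hk (hconj hh hs)
    rwa [hk1, hk2] at this
  rw [eq_top_iff, ← Equiv.Perm.closure_isSwap, Subgroup.closure_le]
  rintro _ ⟨c, d, hcd, rfl⟩
  by_cases hd : d = h x
  · rw [hd, Equiv.swap_comm]
    exact hstar c
  have := hconj (hstar c) (hstar d)
  rwa [Equiv.swap_apply_left, Equiv.swap_apply_of_ne_of_ne hd hcd.symm] at this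

end PermGroup

/-- The splitting type with a single irreducible factor, of degree `k`. -/
def singleType (n k : ℕ) (i : Fin n) : ℕ := if (i : ℕ) + 1 = k then 1 else 0

lemma sum_mul_singleType {n k : ℕ} (hk : 1 ≤ k) (hkn : k ≤ n) :
    ∑ i : Fin n, ((i : ℕ) + 1) * singleType n k i = k := by
  rw [sum_eq_single (⟨k - 1, by omega⟩ : Fin n)]
  · simp [singleType, Nat.sub_add_cancel hk]
  · intro i _ hi
    have : (i : ℕ) + 1 ≠ k := fun h => hi (Fin.ext (by simp; omega))
    simp [singleType, this]
  · simp

/-- The splitting type of a transposition. -/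
def swapType (n : ℕ) (i : Fin n) : ℕ := (n - 2) * singleType n 1 i + singleType n 2 i

/-- The splitting type with one factor of degree `1` and one of degree `n - 1`. -/
def pointStabType (n : ℕ) (i : Fin n) : ℕ := singleType n 1 i + singleType n (n - 1) i

lemma sum_mul_swapType {n : ℕ} (hn : 2 ≤ n) :
    ∑ i : Fin n, ((i : ℕ) + 1) * swapType n i = n := by
  simp only [swapType, mul_add, mul_left_comm _ (n - 2), sum_add_distrib, ← mul_sum]
  rw [sum_mul_singleType le_rfl (by omega), sum_mul_singleType (by omega) hn]
  omega

lemma sum_mul_pointStabType {n : ℕ} (hn : 2 ≤ n) :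
    ∑ i : Fin n, ((i : ℕ) + 1) * pointStabType n i = n := by
  simp only [pointStabType, mul_add, sum_add_distrib]
  rw [sum_mul_singleType le_rfl (by omega), sum_mul_singleType (by omega) (by omega)]
  omega

lemma eq_top_of_splitting_types {n : ℕ} (hn : 2 ≤ n) {Ω : Type*} [Fintype Ω]
    (hΩ : Fintype.card Ω = n) {H : Subgroup (Equiv.Perm Ω)}
    (hH : ∀ r ∈ ({singleType n n, swapType n, pointStabType n} : Set (Fin n → ℕ)),
      ∃ s ∈ H, ∀ i : Fin n, #{ω | Function.minimalPeriod s ω = i + 1} = (i + 1) * r i) :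
    H = ⊤ := by
  apply eq_top_of_exists_swap
  · obtain ⟨s, hs, hcount⟩ := hH (singleType n n) (by simp)
    have h1 := hcount ⟨n - 1, by omega⟩
    simp only [singleType, Nat.sub_add_cancel (by omega : 1 ≤ n), if_true, mul_one] at h1
    have h2 : ({ω | Function.minimalPeriod s ω = n} : Finset Ω) = univ := by
      rw [← card_eq_iff_eq_univ, h1, hΩ]
    have h3 : ∀ ω, Function.minimalPeriod s ω = n := fun ω => by
      have := mem_univ ω
      rw [← h2] at this
      exact (mem_filter.1 this).2
    intro b c
    obtain ⟨k, hk⟩ := exists_pow_apply_eq_of_card_minimalPeriod h1 (h3 b) (h3 c)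
    exact ⟨s ^ k, H.pow_mem hs k, hk⟩
  · obtain ⟨s, hs, hcount⟩ := hH (swapType n) (by simp)
    have h1 := hcount ⟨0, by omega⟩
    have e : ¬ 1 = 2 := by omega
    simp only [swapType, singleType, zero_add, e, if_true, if_false, mul_one, one_mul,
      add_zero] at h1
    exact ⟨s, hs, isSwap_of_card_minimalPeriod_one (by omega)⟩
  · rcases hn.eq_or_lt with rfl | hn3
    · have : Nonempty Ω := Fintype.card_pos_iff.1 (by omega)
      obtain ⟨ω⟩ := this
      refine ⟨ω, fun b hb c hc => ⟨1, H.one_mem, rfl, ?_⟩⟩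
      by_contra hbc
      have := Finset.card_le_univ ({ω, b, c} : Finset Ω)
      rw [hΩ, card_eq_three.2 ⟨ω, b, c, hb.symm, hc.symm, hbc, rfl⟩] at this
      omega
    · obtain ⟨s, hs, hcount⟩ := hH (pointStabType n) (by simp)
      have h1 := hcount ⟨0, by omega⟩
      have h2 := hcount ⟨n - 2, by omega⟩
      have e1 : n - 2 + 1 = n - 1 := by omega
      have e2 : ¬ n - 1 = 1 := by omega
      have e3 : ¬ 1 = n - 1 := by omega
      simp only [pointStabType, singleType, zero_add, e3, if_true, if_false, mul_one,
        add_zero] at h1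
      simp only [pointStabType, singleType, e1, e2, if_true, if_false, zero_add, mul_one] at h2
      obtain ⟨ω, hω⟩ := card_eq_one.1 h1
      have hfix : ∀ b, b ≠ ω → Function.minimalPeriod s b = n - 1 := by
        have hsub : ({b | Function.minimalPeriod s b = n - 1} : Finset Ω) = univ.erase ω := by
          refine eq_of_subset_of_card_le ?_ ?_
          · intro b hb
            refine mem_erase.2 ⟨?_, mem_univ _⟩
            rintro rfl
            have : b ∈ ({b} : Finset Ω) := mem_singleton_self _
            rw [← hω] at this
            exact e2 ((mem_filter.1 hb).2.symm.trans (mem_filter.1 this).2)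
          · rw [h2, card_erase_of_mem (mem_univ _), card_univ, hΩ]
        intro b hb
        have : b ∈ univ.erase ω := mem_erase.2 ⟨hb, mem_univ _⟩
        rw [← hsub] at this
        exact (mem_filter.1 this).2
      refine ⟨ω, fun b hb c hc => ?_⟩
      obtain ⟨k, hk⟩ := exists_pow_apply_eq_of_card_minimalPeriod h2 (hfix b hb) (hfix c hc)
      refine ⟨s ^ k, H.pow_mem hs k, ?_, hk⟩
      have : ω ∈ ({ω} : Finset Ω) := mem_singleton_self _
      rw [← hω] at this
      have hfp := Function.minimalPeriod_eq_one_iff_isFixedPt.1 (mem_filter.1 this).2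
      rw [Equiv.Perm.coe_pow]
      exact hfp.iterate k

lemma isSnPoly_of_splits_numberField {n : ℕ} (hn : 2 ≤ n) {a : Fin n → ℤ}
    (E : Type*) [Field E] [NumberField E] [IsGalois ℚ E]
    [hE : Fact ((ratPoly n a).map (algebraMap ℚ E)).Splits]
    (h : ∀ r ∈ ({singleType n n, swapType n, pointStabType n} : Set (Fin n → ℕ)),
      ∃ p : ℕ, p.Prime ∧ HasSplitType n r a p) : IsSnPoly n a := by
  have hmonic : (intPoly n a).Monic := monic_monicPoly n a
  have hdeg : (intPoly n a).natDegree = n := natDegree_monicPoly n a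
  have hcard : Fintype.card ((ratPoly n a).rootSet E) = n := by
    obtain ⟨p, hp, hsplit⟩ := h (swapType n) (by simp)
    have := Fact.mk hp
    exact (exists_galActionHom_card_filter_minimalPeriod hmonic E (hsplit := hE)
      (splitTypeOf_iff.1 hsplit).1).1.trans hdeg
  have htop : (Gal.galActionHom (ratPoly n a) E).range = ⊤ := by
    refine eq_top_of_splitting_types hn hcard fun r hr => ?_
    obtain ⟨p, hp, hsplit⟩ := h r hr
    have := Fact.mk hp
    obtain ⟨s, hs, hcount⟩ := (exists_galActionHom_card_filter_minimalPeriod hmonic E (hsplit := hE)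
      (splitTypeOf_iff.1 hsplit).1).2
    refine ⟨s, hs, fun i => ?_⟩
    rw [← (splitTypeOf_iff.1 hsplit).2 i]
    exact hcount _
  have hbij : Function.Bijective (Gal.galActionHom (ratPoly n a) E) :=
    ⟨Gal.galActionHom_injective _ _, MonoidHom.range_eq_top.1 htop⟩
  exact ⟨(MulEquiv.ofBijective _ hbij).trans
    (Fintype.equivFinOfCardEq hcard).permCongrHom⟩

lemma isSnPoly_of_hasSplitType {n : ℕ} (hn : 2 ≤ n) {a : Fin n → ℤ}
    (h : ∀ r ∈ ({singleType n n, swapType n, pointStabType n} : Set (Fin n → ℕ)),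
      ∃ p : ℕ, p.Prime ∧ HasSplitType n r a p) : IsSnPoly n a := by
  have : NumberField (ratPoly n a).SplittingField :=
    { to_charZero := inferInstance
      to_finiteDimensional := inferInstance }
  have : IsSplittingField ℚ (ratPoly n a).SplittingField (ratPoly n a) :=
    IsSplittingField.splittingField (ratPoly n a)
  have : Normal ℚ (ratPoly n a).SplittingField := Normal.of_isSplittingField (ratPoly n a)
  have : IsGalois ℚ (ratPoly n a).SplittingField := IsGalois.mk
  have : Fact ((ratPoly n a).map (algebraMap ℚ (ratPoly n a).SplittingField)).Splits :=
    ⟨SplittingField.splits _⟩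
  exact isSnPoly_of_splits_numberField hn (ratPoly n a).SplittingField h

lemma tendsto_gaussian_integral_symm :
    Tendsto (fun A : ℝ => (1 / √(2 * Real.pi)) * ∫ t in (-A)..A, Real.exp (-t ^ 2 / 2))
      atTop (nhds 1) := by
  have h_int : MeasureTheory.Integrable (fun t : ℝ => Real.exp (-t ^ 2 / 2)) := by
    convert! integrable_exp_neg_mul_sq (b := (1 / 2 : ℝ)) (by norm_num) using 3
    ring
  have hval : ∫ t : ℝ, Real.exp (-t ^ 2 / 2) = √(2 * Real.pi) := by
    rw [show 2 * Real.pi = Real.pi / (1 / 2) by ring, ← integral_gaussian (1 / 2)]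
    refine MeasureTheory.integral_congr_ae (Eventually.of_forall fun t => ?_)
    ring_nf
  have h := MeasureTheory.intervalIntegral_tendsto_integral h_int tendsto_neg_atTop_atBot tendsto_id
  have h2 := h.const_mul (1 / √(2 * Real.pi))
  rwa [hval, one_div_mul_cancel (by positivity)] at h2

section DensityOne

variable {n : ℕ} {x : ℕ → ℝ}

lemma tendsto_coeffBox_countSplit_eq_zero (hn : 2 ≤ n) {r : Fin n → ℕ}
    (hr : ∑ i : Fin n, ((i : ℕ) + 1) * r i = n) (hx_top : Tendsto x atTop atTop)
    (hx_le : ∀ N : ℕ, 3 ≤ N → x N ≤ (N : ℝ) ^ (1 / Real.log (Real.log N))) :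
    Tendsto (fun N => (#{f ∈ coeffBox n N | countSplit n r f (x N) = 0} : ℝ) / #(coeffBox n N))
      atTop (nhds 0) := by
  have hδ := splitDelta_pos n r
  have hvar : 0 < splitDelta n r - splitDelta n r ^ 2 := by
    nlinarith [splitDelta_lt_one hn hr]
  have hpi : Tendsto (fun N => (primePi (x N) : ℝ)) atTop atTop :=
    tendsto_natCast_atTop_atTop.comp (tendsto_primePi.comp hx_top)
  have hlow : Tendsto (fun N =>
      splitDelta n r / (splitDelta n r - splitDelta n r ^ 2) ^ (1 / 2 : ℝ) *
      (primePi (x N) : ℝ) ^ (1 / 2 : ℝ)) atTop atTop :=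
    ((tendsto_rpow_atTop (by norm_num)).comp hpi).const_mul_atTop (by positivity)
  rw [Metric.tendsto_atTop']
  intro ε hε
  obtain ⟨A, hA, hA0⟩ := ((tendsto_gaussian_integral_symm.eventually
    (lt_mem_nhds (by linarith : 1 - ε < 1))).and (eventually_gt_atTop 0)).exists
  have hbox := (tendsto_coeffBox_normalizedCount hn hr hx_top hx_le
    (by linarith : -A < A)).eventually (lt_mem_nhds hA)
  obtain ⟨N₀, hN₀⟩ := (hbox.and ((hlow.eventually_gt_atTop A).and
    (hpi.eventually_gt_atTop 0))).exists_forall_of_atTop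
  refine ⟨N₀, fun N hN => ?_⟩
  obtain ⟨h1, h2, h3⟩ := hN₀ N hN.le
  have hB : (0 : ℝ) < #(coeffBox n N) := by exact_mod_cast (coeffBox_nonempty n N).card_pos
  rw [Real.dist_eq, sub_zero, abs_of_nonneg (by positivity)]
  have hdisj : #{f ∈ coeffBox n N | countSplit n r f (x N) = 0} +
      #{f ∈ coeffBox n N | -A ≤ normalizedCount n r f (x N) ∧ normalizedCount n r f (x N) ≤ A} ≤
      #(coeffBox n N) := by
    rw [← card_union_of_disjoint]
    · exact card_le_card (union_subset (filter_subset _ _) (filter_subset _ _))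
    · refine disjoint_filter.2 fun f _ h0 hf => ?_
      have hval : normalizedCount n r f (x N) =
          -(splitDelta n r / (splitDelta n r - splitDelta n r ^ 2) ^ (1 / 2 : ℝ) *
            (primePi (x N) : ℝ) ^ (1 / 2 : ℝ)) := by
        have hs : (primePi (x N) : ℝ) =
            (primePi (x N) : ℝ) ^ (1 / 2 : ℝ) * (primePi (x N) : ℝ) ^ (1 / 2 : ℝ) := by
          rw [← Real.rpow_add h3]
          norm_num
        have h4 := Real.rpow_pos_of_pos h3 (1 / 2)
        have h5 := Real.rpow_pos_of_pos hvar (1 / 2)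
        rw [normalizedCount, h0]
        generalize (primePi (x N) : ℝ) ^ (1 / 2 : ℝ) = q at *
        rw [hs]
        generalize (splitDelta n r - splitDelta n r ^ 2) ^ (1 / 2 : ℝ) = v at *
        field_simp
        simp
      linarith [hf.1]
  have hdisj' : (#{f ∈ coeffBox n N | countSplit n r f (x N) = 0} : ℝ) +
      #{f ∈ coeffBox n N | -A ≤ normalizedCount n r f (x N) ∧ normalizedCount n r f (x N) ≤ A} ≤
      #(coeffBox n N) := by exact_mod_cast hdisj
  rw [lt_div_iff₀ hB] at h1
  rw [div_lt_iff₀ hB]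
  linarith

lemma tendsto_card_P0_div (hn : 2 ≤ n) (hx_top : Tendsto x atTop atTop)
    (hx_le : ∀ N : ℕ, 3 ≤ N → x N ≤ (N : ℝ) ^ (1 / Real.log (Real.log N))) :
    Tendsto (fun N => (#(P0 n N) : ℝ) / #(coeffBox n N)) atTop (nhds 1) := by
  have h := fun (r : Fin n → ℕ) hr =>
    tendsto_coeffBox_countSplit_eq_zero hn (r := r) hr hx_top hx_le
  have hlow := tendsto_const_nhds (x := (1 : ℝ)).sub
    (((h _ (sum_mul_singleType (by omega) le_rfl)).add (h _ (sum_mul_swapType hn))).add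
      (h _ (sum_mul_pointStabType hn)))
  simp only [add_zero, sub_zero] at hlow
  refine tendsto_of_tendsto_of_tendsto_of_le_of_le hlow tendsto_const_nhds (fun N => ?_)
    (fun N => div_le_one_of_le₀ (Nat.cast_le.2 (card_le_card (filter_subset _ _)))
      (Nat.cast_nonneg _))
  have hB : (0 : ℝ) < #(coeffBox n N) := by exact_mod_cast (coeffBox_nonempty n N).card_pos
  have hcover : coeffBox n N ⊆ P0 n N ∪
      (({f ∈ coeffBox n N | countSplit n (singleType n n) f (x N) = 0} ∪
        {f ∈ coeffBox n N | countSplit n (swapType n) f (x N) = 0}) ∪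
        {f ∈ coeffBox n N | countSplit n (pointStabType n) f (x N) = 0}) := by
    intro f hf
    by_contra hnot
    simp only [mem_union, mem_filter, hf, true_and, not_or, P0] at hnot
    obtain ⟨hS, ⟨h1, h2⟩, h3⟩ := hnot
    have hex : ∀ r : Fin n → ℕ, countSplit n r f (x N) ≠ 0 →
        ∃ p : ℕ, p.Prime ∧ HasSplitType n r f p := fun r hr => by
      obtain ⟨p, hp⟩ := card_ne_zero.1 hr
      exact ⟨p, (mem_filter.1 hp).2⟩
    refine hS (isSnPoly_of_hasSplitType hn fun r hr => hex r ?_)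
    rcases hr with rfl | rfl | rfl <;> assumption
  have hcard := (card_le_card hcover).trans ((card_union_le _ _).trans
    (Nat.add_le_add_left ((card_union_le _ _).trans
      (Nat.add_le_add_right (card_union_le _ _) _)) _))
  rw [← add_div, ← add_div, one_sub_div hB.ne']
  refine div_le_div_of_nonneg_right ?_ hB.le
  rw [sub_le_iff_le_add]
  have := Nat.cast_le (α := ℝ).2 hcard
  push_cast at this
  linarith

lemma tendsto_probN_of_tendsto_coeffBox {L : ℝ} {E : ℕ → (Fin n → ℤ) → Prop}
    (hP : Tendsto (fun N => (#(P0 n N) : ℝ) / #(coeffBox n N)) atTop (nhds 1))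
    (hE : Tendsto (fun N => (#{f ∈ coeffBox n N | E N f} : ℝ) / #(coeffBox n N)) atTop (nhds L)) :
    Tendsto (fun N => probN n N (E N)) atTop (nhds L) := by
  have hdiff : Tendsto (fun N => (#{f ∈ coeffBox n N | E N f} : ℝ) / #(coeffBox n N) -
      (#{f ∈ P0 n N | E N f} : ℝ) / #(coeffBox n N)) atTop (nhds 0) := by
    have hone := tendsto_const_nhds (x := (1 : ℝ)).sub hP
    rw [sub_self] at hone
    refine squeeze_zero (fun N => ?_) (fun N => ?_) hone
    · rw [sub_nonneg]
      gcongr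
      exact filter_subset _ _
    · have hB : (0 : ℝ) < #(coeffBox n N) := by exact_mod_cast (coeffBox_nonempty n N).card_pos
      rw [← sub_div, one_sub_div hB.ne']
      refine div_le_div_of_nonneg_right ?_ hB.le
      rw [sub_le_iff_le_add, sub_add_eq_add_sub, le_sub_iff_add_le]
      have hsub : #{f ∈ coeffBox n N | E N f} ≤
          #{f ∈ P0 n N | E N f} + #(coeffBox n N \ P0 n N) := by
        refine (card_le_card fun f hf => ?_).trans (card_union_le _ _)
        rw [mem_filter] at hf
        by_cases h : f ∈ P0 n N
        · exact mem_union_left _ (mem_filter.2 ⟨h, hf.2⟩)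
        · exact mem_union_right _ (mem_sdiff.2 ⟨hf.1, h⟩)
      have hadd : #(coeffBox n N \ P0 n N) + #(P0 n N) = #(coeffBox n N) :=
        card_sdiff_add_card_eq_card (filter_subset _ _)
      exact_mod_cast (by omega : #{f ∈ coeffBox n N | E N f} + #(P0 n N) ≤
        #(coeffBox n N) + #{f ∈ P0 n N | E N f})
  have h := (hE.sub hdiff).div hP one_ne_zero
  simp only [sub_sub_cancel, sub_zero, div_one] at h
  refine h.congr fun N => ?_
  have hB : (#(coeffBox n N) : ℝ) ≠ 0 := by exact_mod_cast (coeffBox_nonempty n N).card_pos.ne'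
  exact div_div_div_cancel_right₀ hB _ _

end DensityOne

/-- **Central Limit Theorem for primes of a given splitting type** (Theorem 4.1).
For a splitting type `r`, `x = x(N) → ∞` with `x(N) ≤ N^{1/log log N}` and reals `a < b`,
`ℙ_N( a ≤ (π_{f,r}(x) − δ(r)π(x))/((δ(r)−δ(r)²)^{1/2}·π(x)^{1/2}) ≤ b )` tends to
`(1/√(2π))·∫_a^b e^{−t²/2} dt` as `N → ∞`. -/
theorem clt_splitting_type (n : ℕ) (hn : 2 ≤ n) (r : Fin n → ℕ)
    (hr : ∑ i : Fin n, ((i : ℕ) + 1) * r i = n) (x : ℕ → ℝ)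
    (hx_top : Tendsto x atTop atTop)
    (hx_le : ∀ N : ℕ, 3 ≤ N → x N ≤ (N : ℝ) ^ (1 / Real.log (Real.log N)))
    (a b : ℝ) (hab : a < b) :
    Tendsto (fun N : ℕ =>
        probN n N fun f =>
          a ≤ ((countSplit n r f (x N) : ℝ) - splitDelta n r * (primePi (x N) : ℝ)) /
                ((splitDelta n r - splitDelta n r ^ 2) ^ ((1 : ℝ) / 2) *
                  (primePi (x N) : ℝ) ^ ((1 : ℝ) / 2)) ∧
            ((countSplit n r f (x N) : ℝ) - splitDelta n r * (primePi (x N) : ℝ)) /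
                ((splitDelta n r - splitDelta n r ^ 2) ^ ((1 : ℝ) / 2) *
                  (primePi (x N) : ℝ) ^ ((1 : ℝ) / 2)) ≤ b)
      atTop
      (nhds ((1 / Real.sqrt (2 * Real.pi)) * ∫ t in a..b, Real.exp (-t ^ 2 / 2))) := by
  change Tendsto (fun N => probN n N fun f =>
    a ≤ normalizedCount n r f (x N) ∧ normalizedCount n r f (x N) ≤ b) atTop _
  refine tendsto_probN_of_tendsto_coeffBox (tendsto_card_P0_div hn hx_top hx_le) ?_
  convert! tendsto_coeffBox_normalizedCount hn hr hx_top hx_le hab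

end
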